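/- arXiv:0712.3954 — 4 statements merged into one kernel-verified Lean document; each statement's English description precedes it below -/
import Mathlib

section
/- Let r and s be nonzero integers with r > 0 and gcd(r, s) = 1, and let n ≥ 2. Then there are only finitely many tuples (q_1, …, q_n) of positive integers satisfying the cyclic system of congruences r·((∏_{k=1}^n q_k)/q_i) ≡ s (mod q_i) for all 1 ≤ i ≤ n, together with the side conditions that at least two of the q_i are ≥ 2 and gcd(q_1·q_2⋯q_n, s) = 1. Moreover, every such solution satisfies max_i q_i ≤ max{u_n(r) − s − 1, s²} if s > 0, and max_i q_i ≤ max{u_n(r) − s − 1, |s|} if s < 0. -/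
open Finset

/-- Majorization: increasing `x` with dominating partial products has smaller reciprocal sum. -/
theorem cc_major (x y : ℕ → ℝ) (j n : ℕ) (hjn : j ≤ n) (hx : ∀ i, j ≤ i → i < n → 0 < x i)
    (hy : ∀ i, j ≤ i → i < n → 0 < y i)
    (hmono : ∀ i, j ≤ i → i + 1 < n → x i ≤ x (i + 1))
    (hprod : ∀ l, j ≤ l → l ≤ n → ∏ i ∈ Finset.Ico j l, y i ≤ ∏ i ∈ Finset.Ico j l, x i) :
    ∑ i ∈ Finset.Ico j n, 1 / x i ≤ ∑ i ∈ Finset.Ico j n, 1 / y i := by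
  have hXp : ∀ l, l ≤ n → 0 < ∏ i ∈ Finset.Ico j l, x i := fun l hl =>
    Finset.prod_pos fun i hi => by
      rw [Finset.mem_Ico] at hi; exact hx i hi.1 (by omega)
  have hYp : ∀ l, l ≤ n → 0 < ∏ i ∈ Finset.Ico j l, y i := fun l hl =>
    Finset.prod_pos fun i hi => by
      rw [Finset.mem_Ico] at hi; exact hy i hi.1 (by omega)
  have hL : ∀ l, j ≤ l → l ≤ n →
      0 ≤ Real.log (∏ i ∈ Finset.Ico j l, x i) - Real.log (∏ i ∈ Finset.Ico j l, y i) := by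
    intro l h1 h2
    have := Real.log_le_log (hYp l h2) (hprod l h1 h2)
    linarith
  have key : ∀ l, j ≤ l → l < n →
      (1 / x l) * (Real.log (∏ i ∈ Finset.Ico j (l+1), x i)
        - Real.log (∏ i ∈ Finset.Ico j (l+1), y i))
        ≤ ∑ i ∈ Finset.Ico j (l+1), 1 / y i - ∑ i ∈ Finset.Ico j (l+1), 1 / x i := by
    have one : ∀ l, j ≤ l → l < n →
        (1 / x l) * (Real.log (x l) - Real.log (y l)) ≤ 1 / y l - 1 / x l := by
      intro l h1 h2
      have a := hx l h1 h2
      have b := hy l h1 h2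
      rw [← Real.log_div a.ne' b.ne']
      have := Real.log_le_sub_one_of_pos (div_pos a b)
      have h3 : 1 / y l - 1 / x l = (1 / x l) * (x l / y l - 1) := by field_simp
      rw [h3]
      exact mul_le_mul_of_nonneg_left this (by positivity)
    intro l hl
    induction l, hl using Nat.le_induction with
    | base =>
      intro h
      simpa using one j le_rfl h
    | succ l hl ih =>
      intro h
      have ih := ih (by omega)
      rw [Finset.prod_Ico_succ_top (by omega : j ≤ l+1), Finset.prod_Ico_succ_top (by omega : j ≤ l+1),
        Finset.sum_Ico_succ_top (by omega : j ≤ l+1), Finset.sum_Ico_succ_top (by omega : j ≤ l+1),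
        Real.log_mul (hXp _ (by omega)).ne' (hx _ (by omega) h).ne',
        Real.log_mul (hYp _ (by omega)).ne' (hy _ (by omega) h).ne']
      have o := one (l+1) (by omega) h
      have hh := hL (l+1) (by omega) (by omega)
      have hinv : 1 / x (l+1) ≤ 1 / x l :=
        one_div_le_one_div_of_le (hx l hl (by omega)) (hmono l hl h)
      have := mul_le_mul_of_nonneg_right hinv hh
      linarith
  rcases Nat.eq_or_lt_of_le hjn with h | h
  · subst h; simp
  · obtain ⟨p, rfl⟩ : ∃ p, n = p + 1 := ⟨n - 1, by omega⟩
    have k := key p (by omega) (by omega)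
    have := hL (p+1) (by omega) le_rfl
    have h2 := hx p (by omega) (by omega)
    have : 0 ≤ (1 / x p) * (Real.log (∏ i ∈ Finset.Ico j (p+1), x i)
        - Real.log (∏ i ∈ Finset.Ico j (p+1), y i)) := by positivity
    linarith

/-- Products of the extremal sequence. -/
def ccU (r : ℤ) : ℕ → ℤ
  | 0 => 1
  | k + 1 => ccU r k * (r * ccU r k + 1)

/-- Numerators of the remainders. -/
def ccN (r m : ℤ) (x : ℕ → ℤ) : ℕ → ℤ
  | 0 => m
  | k + 1 => ccN r m x k * x k - r * ∏ i ∈ Finset.range k, x i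

theorem ccU_pos (r : ℤ) (hr : 0 < r) (k : ℕ) : 0 < ccU r k := by
  induction k with
  | zero => simp [ccU]
  | succ k ih => simp only [ccU]; positivity

theorem ccU_prod (r : ℤ) (k : ℕ) : ccU r k = ∏ i ∈ Finset.range k, (r * ccU r i + 1) := by
  induction k with
  | zero => simp [ccU]
  | succ k ih => rw [Finset.prod_range_succ, ← ih]; rfl

theorem ccU_sum (r : ℤ) (hr : 0 < r) (j l : ℕ) (h : j ≤ l) :
    (1 : ℝ) / ccU r l = 1 / ccU r j - r * ∑ i ∈ Finset.Ico j l, 1 / (r * ccU r i + 1 : ℝ) := by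
  induction l, h using Nat.le_induction with
  | base => simp
  | succ l hl ih =>
    rw [Finset.sum_Ico_succ_top hl, mul_add, ← sub_sub, ← ih]
    have h1 : (0:ℝ) < ccU r l := by exact_mod_cast ccU_pos r hr l
    have h2 : (0:ℝ) < r := by exact_mod_cast hr
    simp only [ccU]; push_cast
    field_simp
    ring

theorem ccN_sum (r m : ℤ) (x : ℕ → ℤ) (j l : ℕ) (h : j ≤ l) (hx : ∀ i < l, 0 < x i) :
    (ccN r m x l : ℝ) / ((∏ i ∈ Finset.range l, x i : ℤ) : ℝ)
      = ccN r m x j / ((∏ i ∈ Finset.range j, x i : ℤ) : ℝ)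
        - r * ∑ i ∈ Finset.Ico j l, 1 / (x i : ℝ) := by
  induction l, h using Nat.le_induction with
  | base => simp
  | succ l hl ih =>
    rw [Finset.sum_Ico_succ_top hl, mul_add, ← sub_sub, ← ih (fun i hi => hx i (by omega))]
    have h1 : (0:ℝ) < ((∏ i ∈ Finset.range l, x i : ℤ) : ℝ) := by
      exact_mod_cast Finset.prod_pos fun i hi => hx i (by rw [Finset.mem_range] at hi; omega)
    have h2 : (0:ℝ) < x l := by exact_mod_cast hx l (by omega)
    rw [Finset.prod_range_succ]
    simp only [ccN]
    push_cast at h1 ⊢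
    field_simp

theorem ccN_pos (r m : ℤ) (hr : 0 < r) (x : ℕ → ℤ) (n : ℕ) (hx : ∀ i < n, 0 < x i)
    (hN : 0 < ccN r m x n) : ∀ j ≤ n, 0 < ccN r m x j := by
  induction n with
  | zero => intro j hj; obtain rfl : j = 0 := by omega
            exact hN
  | succ n ih =>
    have h1 : 0 < ∏ i ∈ Finset.range n, x i :=
      Finset.prod_pos fun i hi => hx i (by rw [Finset.mem_range] at hi; omega)
    have h2 := hx n (by omega)
    have h3 : 0 < ccN r m x n := by
      simp only [ccN] at hN
      have : 0 < ccN r m x n * x n := by nlinarith [mul_pos hr h1]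
      exact pos_of_mul_pos_left this h2.le
    intro j hj
    rcases Nat.eq_or_lt_of_le hj with h | h
    · subst h; exact hN
    · exact ih (fun i hi => hx i (by omega)) h3 j (by omega)

/-- The contradiction case: last term too small. -/
theorem cc_small (r m : ℤ) (hr : 0 < r) (x : ℕ → ℤ) (p : ℕ)
    (hx : ∀ i < p + 1, 0 < x i) (hmono : ∀ i, i + 1 < p + 1 → x i ≤ x (i + 1))
    (hN : ∀ j ≤ p + 1, 0 < ccN r m x j)
    (ih : ∀ j < p + 1, ∏ i ∈ Finset.range j, x i ≤ ccN r m x j * ccU r j)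
    (hsm : x p ≤ r * ccU r p) :
    ∏ i ∈ Finset.range (p + 1), x i + (ccN r m x (p + 1) - 1) * ccU r p
      ≤ ccN r m x (p + 1) * ccU r (p + 1) := by
  by_contra hcon
  push Not at hcon
  have hA := ccU_pos r hr p
  have hN1 := hN (p+1) le_rfl
  set N := ccN r m x (p+1) with hNdef
  set A := ccU r p with hAdef
  have hU : ccU r (p+1) = A * (r * A + 1) := rfl
  have hwpos : ∀ i, 0 < r * ccU r i + 1 := fun i => by
    have := ccU_pos r hr i; positivity
  have hQU : ∏ i ∈ Finset.range (p+1), (r * ccU r i + 1) < ∏ i ∈ Finset.range (p+1), x i := by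
    rw [← ccU_prod, hU]
    rw [hU] at hcon
    nlinarith [mul_nonneg (sub_nonneg.2 (show 1 ≤ N from hN1)) (mul_pos hr (mul_pos hA hA)).le]
  -- choose the largest index
  obtain ⟨j, hj, hjp, hjmax⟩ : ∃ j, j ≤ p ∧
      ∏ i ∈ Finset.Ico j (p+1), (r * ccU r i + 1) < ∏ i ∈ Finset.Ico j (p+1), x i ∧
      ∀ l, j < l → l ≤ p + 1 →
        ∏ i ∈ Finset.Ico l (p+1), x i ≤ ∏ i ∈ Finset.Ico l (p+1), (r * ccU r i + 1) := by
    classical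
    let P : ℕ → Prop := fun j =>
      ∏ i ∈ Finset.Ico j (p+1), (r * ccU r i + 1) < ∏ i ∈ Finset.Ico j (p+1), x i
    have h0 : P 0 := by simpa only [P, ← Finset.range_eq_Ico] using hQU
    refine ⟨Nat.findGreatest P p, Nat.findGreatest_le p,
      Nat.findGreatest_spec (P := P) (Nat.zero_le p) h0, ?_⟩
    intro l h1 h2
    rcases Nat.eq_or_lt_of_le h2 with h | h
    · subst h; simp
    · have := Nat.findGreatest_is_greatest (P := P) h1 (by omega)
      simpa only [P, not_lt] using this
  have hpre : ∀ l, j ≤ l → l ≤ p + 1 →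
      ∏ i ∈ Finset.Ico j l, (r * ccU r i + 1) ≤ ∏ i ∈ Finset.Ico j l, x i := by
    intro l h1 h2
    rcases Nat.eq_or_lt_of_le h1 with h | h
    · subst h; simp
    have a := hjmax l h h2
    rw [← Finset.prod_Ico_consecutive _ h1 h2, ← Finset.prod_Ico_consecutive _ h1 h2] at hjp
    have b : 0 < ∏ i ∈ Finset.Ico l (p+1), (r * ccU r i + 1) := Finset.prod_pos fun i _ => hwpos i
    have c : 0 < ∏ i ∈ Finset.Ico j l, x i := Finset.prod_pos fun i hi => by
      rw [Finset.mem_Ico] at hi; exact hx i (by omega)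
    by_contra hc
    push Not at hc
    have := mul_le_mul hc.le a (Finset.prod_pos fun i hi => by
      rw [Finset.mem_Ico] at hi; exact hx i (by omega)).le (c.trans hc).le
    linarith
  have hjne : j ≠ p := by
    rintro rfl
    rw [Finset.prod_Ico_succ_top le_rfl, Finset.prod_Ico_succ_top le_rfl, Finset.Ico_self,
      Finset.prod_empty, Finset.prod_empty, one_mul, one_mul, ← hAdef] at hjp
    linarith
  obtain ⟨p, rfl⟩ : ∃ t, p = t + 1 := ⟨p - 1, by omega⟩
  have hB := ccU_pos r hr p
  set B := ccU r p with hBdef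
  have hAB : A = B * (r * B + 1) := rfl
  -- small exceptional case
  by_cases hrB : r * B = 1
  · have hr1 : r = 1 := by nlinarith
    have hB1 : B = 1 := by nlinarith
    have hp0 : p = 0 := by
      rcases p with _ | p
      · rfl
      · exfalso
        have h3 := ccU_pos r hr p
        have : B = ccU r p * (r * ccU r p + 1) := rfl
        rw [hr1] at this h3
        nlinarith
    subst hp0
    have hA2 : A = 2 := by rw [hAB, hB1, hr1]; norm_num
    rw [hU, hA2, hr1] at hcon
    rw [hA2, hr1] at hsm
    have h01 := hmono 0 (by omega)
    have hx0 := hx 0 (by omega)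
    simp [Finset.prod_range_succ] at hcon hsm h01
    nlinarith
  have hrB2 : 2 ≤ r * B := by
    have : 0 < r * B := by positivity
    omega
  have rr : (0:ℝ) < r := by exact_mod_cast hr
  have rB : (0:ℝ) < B := by exact_mod_cast hB
  have rA : (0:ℝ) < A := by exact_mod_cast hA
  have rrB : (2:ℝ) ≤ r * B := by exact_mod_cast hrB2
  have rAB : (A:ℝ) = B * (r * B + 1) := by rw [hAB]; push_cast; ring
  let y : ℕ → ℝ := fun i => if i = p + 1 then r * A else
    if i = p then (r * B + 1) * (r * A + 1) / (r * A) else r * ccU r i + 1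
  have hyl : ∀ i, i < p → y i = r * ccU r i + 1 := fun i hi => by
    simp only [y]; rw [if_neg (by omega), if_neg (by omega)]
  have hyp : y p = (r * B + 1) * (r * A + 1) / (r * A) := by
    simp only [y]; simp
  have hyp1 : y (p+1) = r * A := by
    simp [y]
  have hypos : ∀ i, 0 < y i := by
    intro i
    have : (0:ℝ) < ccU r i := by exact_mod_cast ccU_pos r hr i
    simp only [y]; split_ifs <;> positivity
  have hpreR : ∀ l, j ≤ l → l ≤ p + 2 →
      ∏ i ∈ Finset.Ico j l, (r * ccU r i + 1 : ℝ) ≤ ∏ i ∈ Finset.Ico j l, (x i : ℝ) := by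
    intro l h1 h2
    exact_mod_cast hpre l h1 h2
  have hylow : ∀ l, l ≤ p → ∏ i ∈ Finset.Ico j l, y i
      = ∏ i ∈ Finset.Ico j l, (r * ccU r i + 1 : ℝ) := by
    intro l hl
    refine Finset.prod_congr rfl fun i hi => ?_
    rw [Finset.mem_Ico] at hi
    exact hyl i (by omega)
  have hyfull : ∏ i ∈ Finset.Ico j (p+2), y i
      = ∏ i ∈ Finset.Ico j (p+2), (r * ccU r i + 1 : ℝ) := by
    rw [Finset.prod_Ico_succ_top (by omega), Finset.prod_Ico_succ_top (by omega),
      Finset.prod_Ico_succ_top (by omega), Finset.prod_Ico_succ_top (by omega), hylow p le_rfl,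
      hyp, hyp1, ← hAdef, ← hBdef]
    field_simp
  have maj := cc_major (fun i => (x i : ℝ)) y j (p+2) (by omega)
    (fun i _ hi => by exact_mod_cast hx i (by omega)) (fun i _ _ => hypos i)
    (fun i _ hi => by exact_mod_cast hmono i (by omega))
    (by
      intro l h1 h2
      rcases (by omega : l ≤ p ∨ l = p + 1 ∨ l = p + 2) with h | h | h
      · rw [hylow l h]; exact hpreR l h1 h2
      · subst h
        have e := hpreR (p+2) (by omega) le_rfl
        rw [← hyfull, Finset.prod_Ico_succ_top (by omega : j ≤ p + 1) y,
          Finset.prod_Ico_succ_top (by omega : j ≤ p + 1) (fun i => (x i : ℝ)), hyp1] at e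
        have e2 : (x (p+1) : ℝ) ≤ r * A := by exact_mod_cast hsm
        have e3 : 0 ≤ ∏ i ∈ Finset.Ico j (p+1), (x i : ℝ) := Finset.prod_nonneg fun i hi => by
          rw [Finset.mem_Ico] at hi
          exact_mod_cast (hx i (by omega)).le
        have e4 := mul_le_mul_of_nonneg_left e2 e3
        exact le_of_mul_le_mul_right (e.trans e4) (mul_pos rr rA)
      · subst h; rw [hyfull]; exact hpreR _ h1 le_rfl)
  have sumy : ∑ i ∈ Finset.Ico j (p+2), 1 / y i
      = ∑ i ∈ Finset.Ico j (p+2), 1 / (r * ccU r i + 1 : ℝ)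
        - (1 / (r * B + 1) + 1 / (r * A + 1)
          - (r * A) / ((r * B + 1) * (r * A + 1)) - 1 / (r * A)) := by
    rw [Finset.sum_Ico_succ_top (by omega), Finset.sum_Ico_succ_top (by omega),
      Finset.sum_Ico_succ_top (by omega), Finset.sum_Ico_succ_top (by omega), hyp, hyp1,
      ← hAdef, ← hBdef, one_div_div]
    rw [Finset.sum_congr rfl (g := fun i => 1 / (r * ccU r i + 1 : ℝ)) (fun i hi => by
      rw [Finset.mem_Ico] at hi; rw [hyl i (by omega)])]
    ring
  have sU := ccU_sum r hr j (p+2) (by omega)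
  have sN := ccN_sum r m x j (p+2) (by omega) (fun i hi => hx i (by omega))
  have hQj : (0:ℝ) < ((∏ i ∈ Finset.range j, x i : ℤ) : ℝ) := by
    exact_mod_cast Finset.prod_pos fun i hi => hx i (by rw [Finset.mem_range] at hi; omega)
  have hQn : (0:ℝ) < ((∏ i ∈ Finset.range (p+2), x i : ℤ) : ℝ) := by
    exact_mod_cast Finset.prod_pos fun i hi => hx i (by rw [Finset.mem_range] at hi; omega)
  have hUj : (0:ℝ) < ccU r j := by exact_mod_cast ccU_pos r hr j
  have hRj : (1:ℝ) / ccU r j ≤ ccN r m x j / ((∏ i ∈ Finset.range j, x i : ℤ) : ℝ) := by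
    rw [div_le_div_iff₀ hUj hQj, one_mul]
    exact_mod_cast ih j (by omega)
  have rN : (1:ℝ) ≤ N := by exact_mod_cast hN1
  have hup : (N:ℝ) / ((∏ i ∈ Finset.range (p+2), x i : ℤ) : ℝ) < 1 / (r * A * A) := by
    rw [div_lt_div_iff₀ hQn (by positivity), one_mul]
    rw [hU] at hcon
    have hc : N * (r * A * A) < ∏ i ∈ Finset.range (p+2), x i := by nlinarith
    exact_mod_cast hc
  have hUR : (ccU r (p+2) : ℝ) = A * (r * A + 1) := by exact_mod_cast hU
  have mm := mul_le_mul_of_nonneg_left maj rr.le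
  rw [sumy] at mm
  have gap : 1 / (r * A * A : ℝ) ≤ 1 / (A * (r * A + 1)) + r * (1 / (r * B + 1) + 1 / (r * A + 1)
          - (r * A) / ((r * B + 1) * (r * A + 1)) - 1 / (r * A)) := by
    have e : 1 / (A * (r * A + 1)) + r * (1 / (r * B + 1) + 1 / (r * A + 1)
          - (r * A) / ((r * B + 1) * (r * A + 1)) - 1 / (r * A)) - 1 / (r * A * A : ℝ)
        = (r * (r * A) * A - r * A * (r * B + 1) - (r * B + 1))
          / ((r * B + 1) * (r * A * A) * (r * A + 1)) := by
      field_simp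
      ring
    have e2 : (0:ℝ) ≤ (r * (r * A) * A - r * A * (r * B + 1) - (r * B + 1)) := by
      rw [rAB]
      have : (r * (r * (B * (r * B + 1))) * (B * (r * B + 1)) - r * (B * (r * B + 1)) * (r * B + 1)
        - (r * B + 1) : ℝ) = (r * B + 1) * ((r * B) * (r * B + 1) * (r * B - 1) - 1) := by ring
      rw [this]
      have : (0:ℝ) ≤ ((r * B) * (r * B + 1) * (r * B - 1) - 1) := by
        generalize (r * B : ℝ) = t at *
        nlinarith [mul_nonneg (sub_nonneg.2 rrB) (sub_nonneg.2 rrB)]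
      positivity
    have : 0 ≤ (r * (r * A) * A - r * A * (r * B + 1) - (r * B + 1))
          / ((r * B + 1) * (r * A * A) * (r * A + 1) : ℝ) := by positivity
    linarith
  rw [hUR] at sU
  rw [← hNdef] at sN
  linarith

theorem cc_claim (r m : ℤ) (hr : 0 < r) (x : ℕ → ℤ) (n : ℕ)
    (hx : ∀ i < n, 0 < x i) (hmono : ∀ i, i + 1 < n → x i ≤ x (i + 1))
    (hN : 0 < ccN r m x n) :
    ∏ i ∈ Finset.range n, x i + (ccN r m x n - 1) * ccU r (n - 1)
      ≤ ccN r m x n * ccU r n := by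
  induction n using Nat.strong_induction_on with
  | _ n ih =>
  have hNall := ccN_pos r m hr x n hx hN
  have ih' : ∀ j < n, ∏ i ∈ Finset.range j, x i + (ccN r m x j - 1) ≤ ccN r m x j * ccU r j := by
    intro j hj
    have h := ih j hj (fun i hi => hx i (by omega)) (fun i hi => hmono i (by omega))
      (hNall j hj.le)
    have h1 := hNall j hj.le
    have h2 := ccU_pos r hr (j-1)
    nlinarith
  rcases n with _ | p
  · simp [ccU, ccN]
  rw [Nat.add_sub_cancel]
  by_cases hs : x p ≤ r * ccU r p
  · exact cc_small r m hr x p hx hmono hNall (fun j hj => by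
      have := ih' j hj
      have := hNall j hj.le
      linarith) hs
  · have hd := ih' p (by omega)
    have hNp := hNall p (by omega)
    have hA := ccU_pos r hr p
    rw [Finset.prod_range_succ]
    simp only [ccN, ccU] at hN ⊢
    set A := ccU r p
    set N := ccN r m x p
    set Q := ∏ i ∈ Finset.range p, x i
    obtain ⟨a, ha⟩ : ∃ a, x p = r * A + 1 + a := ⟨x p - (r * A + 1), by ring⟩
    have ha0 : 0 ≤ a := by omega
    obtain ⟨d, hdd⟩ : ∃ d, Q = N * A - d := ⟨N * A - Q, by ring⟩
    have hd0 : N - 1 ≤ d := by linarith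
    have hd1 : 0 ≤ d := by linarith
    rw [ha, hdd]
    have hrA : 1 ≤ r * A := by have := mul_pos hr hA; omega
    have key : 0 ≤ N * A * a * (r * A) + d * (r * A * (r * A + 1) + (r * A + 1) + a)
        - A * (N * (1 + a) + r * d - 1) := by
      have k1 : 0 ≤ N * A * a * (r * A - 1) := by
        have : 0 ≤ r * A - 1 := by omega
        positivity
      have k2 : 0 ≤ d * (r * A * (r * A)) - A * (N - 1) := by
        have : 0 ≤ d * A * (r * (r * A) - 1) := by
          have : 0 ≤ r * (r * A) - 1 := by nlinarith
          positivity
        nlinarith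
      have k3 : 0 ≤ d * (r * A + 1 + a) := by positivity
      nlinarith
    nlinarith

/-- Existence of the integer `m`. -/
theorem cc_exists_m (r s : ℤ) (x : ℕ → ℤ) (n : ℕ)
    (hdvd : ∀ i < n, x i ∣ r * (∏ k ∈ (Finset.range n).erase i, x k) - s)
    (hcop : ∀ i < n, IsCoprime (x i) s) :
    ∃ m, ccN r m x n = - s := by
  have hm : ∀ m l, ccN r m x l = m * ∏ i ∈ Finset.range l, x i + ccN r 0 x l := by
    intro m l
    induction l with
    | zero => simp [ccN]
    | succ l ih => rw [Finset.prod_range_succ]; simp only [ccN]; rw [ih]; ring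
  have hE : ∀ i l, i < l →
      x i ∣ ccN r 0 x l + r * ∏ k ∈ (Finset.range l).erase i, x k := by
    intro i l hl
    induction l, (show i + 1 ≤ l from hl) using Nat.le_induction with
    | base =>
      rw [Finset.range_add_one, Finset.erase_insert (by simp)]
      simp [ccN]
    | succ l hl ih =>
      have ih := ih (by omega)
      rw [Finset.range_add_one, Finset.erase_insert_of_ne (by omega), Finset.prod_insert (by simp)]
      have h1 : x i ∣ ∏ k ∈ Finset.range l, x k :=
        Finset.dvd_prod_of_mem _ (Finset.mem_range.2 (by omega))
      simp only [ccN]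
      have : ccN r 0 x l * x l - r * ∏ i ∈ Finset.range l, x i
          + r * (x l * ∏ k ∈ (Finset.range l).erase i, x k)
          = (ccN r 0 x l + r * ∏ k ∈ (Finset.range l).erase i, x k) * x l
            - r * ∏ i ∈ Finset.range l, x i := by ring
      rw [this]
      exact dvd_sub (ih.mul_right _) (h1.mul_left _)
  have hP : ∏ i ∈ Finset.range n, x i ∣ ccN r 0 x n + s := by
    apply Finset.prod_dvd_of_coprime
    · intro i hi j hj hij
      simp only [Finset.coe_range, Set.mem_Iio] at hi hj
      have h1 : x j ∣ ∏ k ∈ (Finset.range n).erase i, x k :=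
        Finset.dvd_prod_of_mem _ (by simp [hj, Ne.symm hij])
      obtain ⟨c, hc⟩ := hdvd i hi
      obtain ⟨e, he⟩ := h1
      obtain ⟨a, b, hab⟩ := hcop i hi
      show IsCoprime (x i) (x j)
      refine ⟨a - b * c, b * r * e, ?_⟩
      rw [he] at hc
      linear_combination hab + b * hc
    · intro i hi
      rw [Finset.mem_range] at hi
      have := dvd_sub (hE i n hi) (hdvd i hi)
      have e : ccN r 0 x n + s = ccN r 0 x n + r * ∏ k ∈ (Finset.range n).erase i, x k
        - (r * ∏ k ∈ (Finset.range n).erase i, x k - s) := by ring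
      rw [e]; exact this
  obtain ⟨c, hc⟩ := hP
  refine ⟨-c, ?_⟩
  rw [hm]
  linarith

theorem cc_bound (r s : ℤ) (hr : 0 < r) (hs : s ≠ 0) (x : ℕ → ℤ) (p : ℕ)
    (hx : ∀ i < p + 2, 0 < x i) (hmono : ∀ i, i + 1 < p + 2 → x i ≤ x (i + 1))
    (hdvd : ∀ i < p + 2, x i ∣ r * (∏ k ∈ (Finset.range (p + 2)).erase i, x k) - s)
    (hcop : ∀ i < p + 2, IsCoprime (x i) s)
    (h2 : ∃ i < p + 1, 2 ≤ x i) :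
    x (p + 1) ≤ (if 0 < s then max (r * ccU r (p + 1) - s) (s ^ 2)
                  else r * ccU r (p + 1) - s) := by
  obtain ⟨m, hm⟩ := cc_exists_m r s x (p+2) hdvd hcop
  have hQ : 0 < ∏ i ∈ Finset.range (p+1), x i := Finset.prod_pos fun i hi => hx i (by
    rw [Finset.mem_range] at hi; omega)
  have hX := hx (p+1) (by omega)
  have hm' : ccN r m x (p+1) * x (p+1) - r * ∏ i ∈ Finset.range (p+1), x i = - s := hm
  have claim := cc_claim r m hr x (p+1) (fun i hi => hx i (by omega))
    (fun i hi => hmono i (by omega))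
  rw [Nat.add_sub_cancel] at claim
  have hne : r * ∏ i ∈ Finset.range (p+1), x i ≠ s := by
    intro h
    obtain ⟨i, hi, hi2⟩ := h2
    have h1 : x i ∣ s := h ▸ (Finset.dvd_prod_of_mem _ (Finset.mem_range.2 hi)).mul_left r
    have := (hcop i (by omega)).isUnit_of_dvd' dvd_rfl h1
    rw [Int.isUnit_iff] at this
    omega
  have hA := ccU_pos r hr p
  have hU : ccU r (p+1) = ccU r p * (r * ccU r p + 1) := rfl
  have hUp := ccU_pos r hr (p+1)
  set Q := ∏ i ∈ Finset.range (p+1), x i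
  set N := ccN r m x (p+1)
  set X := x (p+1)
  set A := ccU r p
  set U := ccU r (p+1)
  have hrQ := mul_pos hr hQ
  split_ifs with hs0
  · rcases lt_trichotomy N 0 with hN | hN | hN
    · apply le_max_of_le_right
      nlinarith
    · exfalso; rw [hN] at hm'; apply hne; linarith
    · have c := claim hN
      by_contra hc
      rw [not_le, max_lt_iff] at hc
      obtain ⟨c1, c2⟩ := hc
      have hXU : X < r * U := by
        have : N * X < N * (r * U) := by
          nlinarith [mul_nonneg (sub_nonneg.2 (show 1 ≤ N from hN)) hA.le]
        exact lt_of_mul_lt_mul_left this hN.le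
      have hsA : s ≤ r * A := by
        by_contra h
        push Not at h
        rw [hU] at hXU
        have := mul_pos hr hA
        nlinarith
      have : N * X ≤ N * (r * U - s) := by
        nlinarith [mul_nonneg (sub_nonneg.2 (show 1 ≤ N from hN)) (sub_nonneg.2 hsA)]
      have := le_of_mul_le_mul_left this hN
      linarith
  · have hs1 : s < 0 := by omega
    have hN : 0 < N := by
      have : 0 < N * X := by linarith
      exact pos_of_mul_pos_left this hX.le
    have c := claim hN
    have : N * X ≤ N * (r * U - s) := by
      nlinarith [mul_nonneg (sub_nonneg.2 (show 1 ≤ N from hN)) hA.le,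
        mul_nonneg (sub_nonneg.2 (show 1 ≤ N from hN)) (neg_pos.2 hs1).le]
    exact le_of_mul_le_mul_left this hN

theorem cc_u (r : ℤ) (u : ℕ → ℤ) (hu1 : u 1 = r + 1)
    (hu : ∀ k, 1 ≤ k → u (k + 1) = r * (∏ i ∈ Finset.Icc 1 k, u i) + 1) (k : ℕ) :
    u (k + 1) = r * ccU r k + 1 ∧ ∏ i ∈ Finset.Icc 1 k, u i = ccU r k := by
  induction k with
  | zero => simp [ccU, hu1]
  | succ k ih =>
    have h : ∏ i ∈ Finset.Icc 1 (k+1), u i = ccU r (k+1) := by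
      rw [Finset.prod_Icc_succ_top (by omega), ih.1, ih.2]; rfl
    exact ⟨by rw [hu (k+1) (by omega), h], h⟩

theorem cc_main
    (r s : ℤ) (hr : 0 < r) (hs : s ≠ 0)
    (n : ℕ) (hn : 2 ≤ n)
    (u : ℕ → ℤ) (hu1 : u 1 = r + 1)
    (hu : ∀ k, 1 ≤ k → u (k + 1) = r * (∏ i ∈ Finset.Icc 1 k, u i) + 1) 
    (q : Fin n → ℤ) (hq : ∀ i, 0 < q i)
    (hd : ∀ i, q i ∣ r * (∏ k ∈ Finset.univ.erase i, q k) - s)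
    (h2 : ∃ i j, i ≠ j ∧ 2 ≤ q i ∧ 2 ≤ q j)
    (hg : Int.gcd (∏ i, q i) s = 1) (i : Fin n) :
    q i ≤ (if 0 < s then max (u n - s - 1) (s ^ 2)
                  else max (u n - s - 1) |s|) := by
  obtain ⟨p, rfl⟩ : ∃ p, n = p + 2 := ⟨n - 2, by omega⟩
  let σ := Tuple.sort q
  have hσ : Monotone (q ∘ σ) := Tuple.monotone_sort q
  let x : ℕ → ℤ := fun i => if h : i < p + 2 then q (σ ⟨i, h⟩) else 1
  have hxv : ∀ i (h : i < p + 2), x i = q (σ ⟨i, h⟩) := fun i h => by simp [x, h]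
  have hxf : ∀ i : Fin (p+2), x i = q (σ i) := fun i => hxv i i.2
  have hpr : ∀ a (h : a < p + 2),
      ∏ k ∈ (Finset.range (p+2)).erase a, x k = ∏ k ∈ Finset.univ.erase (σ ⟨a, h⟩), q k := by
    intro a h
    symm
    refine Finset.prod_bij (fun k _ => ((σ.symm k : Fin (p+2)) : ℕ)) ?_ ?_ ?_ ?_
    · intro k hk
      simp only [Finset.mem_erase, Finset.mem_univ, and_true, Finset.mem_range] at hk ⊢
      refine ⟨fun e => hk ?_, (σ.symm k).2⟩
      have : σ.symm k = ⟨a, h⟩ := Fin.ext e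
      rw [← this]; simp
    · intro k _ l _ e
      exact σ.symm.injective (Fin.ext e)
    · intro b hb
      simp only [Finset.mem_erase, Finset.mem_range] at hb
      refine ⟨σ ⟨b, hb.2⟩, ?_, by simp⟩
      simp only [Finset.mem_erase, Finset.mem_univ, and_true]
      intro e
      have := σ.injective e
      simp only [Fin.mk.injEq] at this
      exact hb.1 this
    · intro k _
      rw [hxf]; simp
  have hcopq : ∀ a, IsCoprime (q a) s := fun a =>
    (Int.isCoprime_iff_gcd_eq_one.2 hg).of_isCoprime_of_dvd_left
      (Finset.dvd_prod_of_mem _ (Finset.mem_univ a))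
  have B := cc_bound r s hr hs x p (fun a h => by rw [hxv a h]; exact hq _)
    (fun a h => by
      rw [hxv a (by omega), hxv (a+1) h]
      exact hσ (by simp [Fin.le_def]))
    (fun a h => by rw [hpr a h, hxv a h]; exact hd _)
    (fun a h => by rw [hxv a h]; exact hcopq _)
    (by
      obtain ⟨a, b, hab, ha, hb⟩ := h2
      by_cases hl : ((σ.symm a : Fin (p+2)) : ℕ) < p + 1
      · exact ⟨_, hl, by rw [hxf]; simpa using ha⟩
      · refine ⟨(σ.symm b : Fin (p+2)), ?_, by rw [hxf]; simpa using hb⟩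
        have h1 := (σ.symm a).2
        have h2 := (σ.symm b).2
        have h3 : ((σ.symm a : Fin (p+2)) : ℕ) ≠ (σ.symm b : Fin (p+2)) := fun e =>
          hab (σ.symm.injective (Fin.ext e))
        omega)
  have hle : q i ≤ x (p+1) := by
    rw [hxv (p+1) (by omega)]
    have : (q ∘ σ) (σ.symm i) ≤ (q ∘ σ) ⟨p+1, by omega⟩ := hσ (by
      rw [Fin.le_def]; have := (σ.symm i).2; simp only; omega)
    simpa using this
  have hun : u (p+2) - s - 1 = r * ccU r (p+1) - s := by
    rw [(cc_u r u hu1 hu (p+1)).1]; ring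
  rw [hun]
  refine hle.trans (B.trans ?_)
  split_ifs
  · exact le_rfl
  · exact le_max_left _ _

/-- Finiteness of positive solutions of the cyclic system of
congruences, with the sharp upper bound in terms of the sequence `u n r`
(given by `u 1 = r + 1`, `u (n+1) = r * (u 1 * ⋯ * u n) + 1`). -/
theorem cyclic_congruence_positive_finite_and_bound
    (r s : ℤ) (hr : 0 < r) (hs : s ≠ 0) (hrs : Int.gcd r s = 1)
    (n : ℕ) (hn : 2 ≤ n)
    (u : ℕ → ℤ) (hu1 : u 1 = r + 1)
    (hu : ∀ k, 1 ≤ k → u (k + 1) = r * (∏ i ∈ Finset.Icc 1 k, u i) + 1) :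
    {q : Fin n → ℤ |
        (∀ i, 0 < q i) ∧
        (∀ i, q i ∣ r * (∏ k ∈ Finset.univ.erase i, q k) - s) ∧
        (∃ i j, i ≠ j ∧ 2 ≤ q i ∧ 2 ≤ q j) ∧
        Int.gcd (∏ i, q i) s = 1}.Finite ∧
    ∀ q : Fin n → ℤ,
      (∀ i, 0 < q i) →
      (∀ i, q i ∣ r * (∏ k ∈ Finset.univ.erase i, q k) - s) →
      (∃ i j, i ≠ j ∧ 2 ≤ q i ∧ 2 ≤ q j) →
      Int.gcd (∏ i, q i) s = 1 →
      ∀ i, q i ≤ (if 0 < s then max (u n - s - 1) (s ^ 2)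
                  else max (u n - s - 1) |s|) := by
  have main := cc_main r s hr hs n hn u hu1 hu
  refine ⟨?_, main⟩
  refine Set.Finite.subset (Set.finite_Icc (fun _ : Fin n => (0 : ℤ))
    (fun _ => (if 0 < s then max (u n - s - 1) (s ^ 2) else max (u n - s - 1) |s|))) ?_
  rintro q ⟨h1, h2, h3, h4⟩
  exact ⟨fun i => (h1 i).le, fun i => main q h1 h2 h3 h4 i⟩
end

section
/- Let r and s be nonzero integers with r ≥ 1 and gcd(r, s) = 1, and let n ≥ 2. Consider integer solutions (q_1, …, q_n, m) of r·(1/q_1 + ⋯ + 1/q_n) − s/(q_1·q_2⋯q_n) = m with 1 ≤ q_1 ≤ q_2 ≤ ⋯ ≤ q_n, subject to the side condition r·q_1⋯q_{n−1} > s when s > 0, and q_n > |s| when s < 0 (m being unrestricted). There are only finitely many such solutions. Moreover every such solution has m ≥ 1 and satisfies max_i q_i ≤ u_n(r) − 2 if s > 0, and max_i q_i ≤ u_n(r) + |s| − 1 if s < 0. -/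
open Finset

lemma aux_abel (a c : ℕ → ℝ) (ha : Antitone a) (K : ℕ)
    (hS : ∀ k, k ≤ K → 0 ≤ ∑ i ∈ range k, c i) (k : ℕ) (hk : k ≤ K) :
    a k * ∑ i ∈ range k, c i ≤ ∑ i ∈ range k, a i * c i := by
  induction k with
  | zero => simp
  | succ k ih =>
    have h1 := ih (by omega)
    have h2 : a (k+1) * ∑ i ∈ range (k+1), c i ≤ a k * ∑ i ∈ range (k+1), c i :=
      mul_le_mul_of_nonneg_right (ha (Nat.le_succ k)) (hS _ hk)
    refine h2.trans ?_
    rw [sum_range_succ, sum_range_succ, mul_add]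
    linarith

lemma aux_amgm (y : ℕ → ℝ) (hy : ∀ i, 0 < y i) (k : ℕ) (h : 1 ≤ ∏ i ∈ range k, y i) :
    0 ≤ ∑ i ∈ range k, (y i - 1) := by
  have h1 : Real.log (∏ i ∈ range k, y i) = ∑ i ∈ range k, Real.log (y i) :=
    Real.log_prod (fun i _ => (hy i).ne')
  have h2 := Real.log_nonneg h
  rw [h1] at h2
  exact h2.trans (sum_le_sum fun i _ => Real.log_le_sub_one_of_pos (hy i))

lemma aux_int (r : ℤ) (x : ℕ → ℤ) (hx : ∀ i, 1 ≤ x i) (k : ℕ) :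
    ∃ N : ℤ, (∑ i ∈ range k, (r : ℝ) / x i) * ∏ i ∈ range k, (x i : ℝ) = N := by
  induction k with
  | zero => exact ⟨0, by simp⟩
  | succ k ih =>
    obtain ⟨N, hN⟩ := ih
    refine ⟨N * x k + r * ∏ i ∈ range k, x i, ?_⟩
    have hxk : (x k : ℝ) ≠ 0 := by
      have := hx k
      exact_mod_cast (by omega : x k ≠ 0)
    rw [sum_range_succ, prod_range_succ]
    push_cast
    rw [← hN]
    field_simp

lemma aux_def (r m : ℤ) (x : ℕ → ℤ) (hx : ∀ i, 1 ≤ x i) (k : ℕ)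
    (h : ∑ i ∈ range k, (r : ℝ) / x i < m) :
    1 ≤ (m - ∑ i ∈ range k, (r : ℝ) / x i) * ∏ i ∈ range k, (x i : ℝ) := by
  obtain ⟨N, hN⟩ := aux_int r x hx k
  have hP : 0 < ∏ i ∈ range k, (x i : ℝ) := prod_pos fun i _ => by
    have := hx i
    exact_mod_cast (by omega : 0 < x i)
  have h1 : 0 < (m - ∑ i ∈ range k, (r : ℝ) / x i) * ∏ i ∈ range k, (x i : ℝ) :=
    mul_pos (by linarith) hP
  have h2 : (m - ∑ i ∈ range k, (r : ℝ) / x i) * ∏ i ∈ range k, (x i : ℝ)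
      = ((m * ∏ i ∈ range k, x i - N : ℤ) : ℝ) := by
    rw [sub_mul, hN]; push_cast; rfl
  rw [h2] at h1 ⊢
  exact_mod_cast h1

lemma aux_tel (r : ℤ) (v : ℕ → ℤ) (hv0 : ∀ i, 0 < v i)
    (hv : ∀ k, v k = r * (∏ i ∈ range k, v i) + 1) (j l : ℕ) :
    ∑ i ∈ range l, (r : ℝ) / v (j + i)
      = 1 / (∏ i ∈ range j, (v i : ℝ)) - 1 / (∏ i ∈ range (j + l), (v i : ℝ)) := by
  induction l with
  | zero => simp
  | succ l ih =>
    rw [sum_range_succ, ih, ← add_assoc, prod_range_succ _ (j + l)]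
    have hP : 0 < ∏ i ∈ range (j + l), (v i : ℝ) := prod_pos fun i _ => by exact_mod_cast hv0 i
    have hvp : (0 : ℝ) < v (j + l) := by exact_mod_cast hv0 _
    have he : (v (j + l) : ℝ) = r * (∏ i ∈ range (j + l), (v i : ℝ)) + 1 := by
      have := hv (j + l)
      exact_mod_cast this
    have : (r : ℝ) / v (j + l) = 1 / (∏ i ∈ range (j + l), (v i : ℝ))
        - 1 / ((∏ i ∈ range (j + l), (v i : ℝ)) * v (j + l)) := by
      field_simp
      linarith
    rw [this]; ring

lemma aux_main (r : ℤ) (hr : 1 ≤ r) (v : ℕ → ℤ) (hv0 : ∀ i, 0 < v i)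
    (hv : ∀ k, v k = r * (∏ i ∈ range k, v i) + 1)
    (x : ℕ → ℤ) (hx : ∀ i, 1 ≤ x i) (hmono : Monotone x) (m : ℤ) (k : ℕ)
    (h : ∑ i ∈ range k, (r : ℝ) / x i < m) :
    1 / (∏ i ∈ range k, (v i : ℝ)) ≤ m - ∑ i ∈ range k, (r : ℝ) / x i := by
  induction k using Nat.strong_induction_on with
  | _ k ih =>
  have hxp : ∀ i, (0 : ℝ) < x i := fun i => by
    have := hx i
    exact_mod_cast (by omega : 0 < x i)
  have hvp : ∀ i, (0 : ℝ) < v i := fun i => by exact_mod_cast hv0 i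
  have hrp : (0 : ℝ) < r := by exact_mod_cast (by omega : 0 < r)
  by_contra hcon
  push Not at hcon
  have hU : 0 < ∏ i ∈ range k, (v i : ℝ) := prod_pos fun i _ => hvp i
  have hP : 0 < ∏ i ∈ range k, (x i : ℝ) := prod_pos fun i _ => hxp i
  have hd := aux_def r m x hx k h
  have hPU : ∏ i ∈ range k, (v i : ℝ) < ∏ i ∈ range k, (x i : ℝ) := by
    have h1 : 1 < 1 / (∏ i ∈ range k, (v i : ℝ)) * ∏ i ∈ range k, (x i : ℝ) :=
      hd.trans_lt (mul_lt_mul_of_pos_right hcon hP)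
    rw [one_div, inv_mul_eq_div, one_lt_div hU] at h1
    exact h1
  set f : ℕ → ℝ := fun l => ∏ i ∈ range l, ((x i : ℝ) / v i) with hf
  have hfpos : ∀ l, 0 < f l := fun l => prod_pos fun i _ => div_pos (hxp i) (hvp i)
  obtain ⟨j, hj, hmin⟩ := exists_min_image (range (k+1)) f ⟨0, by simp⟩
  have hfk : 1 < f k := by
    simp only [hf]
    rw [prod_div_distrib, one_lt_div hU]
    exact hPU
  have hjk : j < k := by
    have h1 : j ≤ k := by simpa [Nat.lt_succ_iff] using hj
    rcases h1.lt_or_eq with h2 | h2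
    · exact h2
    · have := hmin 0 (by simp)
      rw [h2] at this
      simp only [hf, range_zero, prod_empty] at this hfk
      linarith
  obtain ⟨K, rfl⟩ := Nat.exists_eq_add_of_lt hjk
  rw [add_assoc] at *
  set L := K + 1 with hL
  have hprod : ∀ l, l ≤ L → 1 ≤ ∏ i ∈ range l, ((x (j + i) : ℝ) / v (j + i)) := by
    intro l hl
    have h1 := hmin (j + l) (by simp; omega)
    have h2 : f (j + l) = f j * ∏ i ∈ range l, ((x (j + i) : ℝ) / v (j + i)) := by
      simp only [hf]; rw [prod_range_add]
    rw [h2] at h1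
    exact (le_mul_iff_one_le_right (hfpos j)).1 h1
  have hab := aux_abel (fun i => (r : ℝ) / x (j + i)) (fun i => (x (j + i) : ℝ) / v (j + i) - 1)
    (by
      intro a b hab
      apply div_le_div_of_nonneg_left hrp.le (hxp _)
      exact_mod_cast hmono (by omega)) L
    (fun l hl => aux_amgm (fun i => (x (j + i) : ℝ) / v (j + i))
      (fun i => div_pos (hxp _) (hvp _)) l (hprod l hl)) L le_rfl
  have hnn := aux_amgm (fun i => (x (j + i) : ℝ) / v (j + i))
      (fun i => div_pos (hxp _) (hvp _)) L (hprod L le_rfl)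
  have h3 : 0 ≤ ∑ i ∈ range L, ((r : ℝ) / x (j + i)) * ((x (j + i) : ℝ) / v (j + i) - 1) :=
    le_trans (mul_nonneg (div_pos hrp (hxp _)).le hnn) hab
  have h4 : ∑ i ∈ range L, ((r : ℝ) / x (j + i)) * ((x (j + i) : ℝ) / v (j + i) - 1)
      = ∑ i ∈ range L, (r : ℝ) / v (j + i) - ∑ i ∈ range L, (r : ℝ) / x (j + i) := by
    rw [← sum_sub_distrib]
    refine sum_congr rfl fun i _ => ?_
    have := (hxp (j + i)).ne'
    have := (hvp (j + i)).ne'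
    field_simp
  rw [h4, aux_tel r v hv0 hv j L] at h3
  have h5 : ∑ i ∈ range (j + L), (r : ℝ) / x i
      = ∑ i ∈ range j, (r : ℝ) / x i + ∑ i ∈ range L, (r : ℝ) / x (j + i) := sum_range_add _ _ _
  have h6 : 0 ≤ ∑ i ∈ range L, (r : ℝ) / x (j + i) :=
    sum_nonneg fun i _ => (div_pos hrp (hxp _)).le
  have h7 := ih j hjk (by linarith)
  linarith

lemma aux_bound (r s : ℤ) (hr : 1 ≤ r) (hs : s ≠ 0)
    (v : ℕ → ℤ) (hv0 : ∀ i, 0 < v i)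
    (hv : ∀ k, v k = r * (∏ i ∈ range k, v i) + 1)
    (x : ℕ → ℤ) (hx : ∀ i, 1 ≤ x i) (hmono : Monotone x) (m : ℤ) (k : ℕ)
    (heq : ∑ i ∈ range (k + 1), (r : ℝ) / x i - s / ∏ i ∈ range (k + 1), (x i : ℝ) = m)
    (hpos : 0 < s → s < r * ∏ i ∈ range k, x i) :
    1 ≤ m ∧ x k ≤ (if 0 < s then v k - 2 else v k + |s| - 1) := by
  have hxp : ∀ i, (0 : ℝ) < x i := fun i => by
    have := hx i
    exact_mod_cast (by omega : 0 < x i)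
  have hvp : ∀ i, (0 : ℝ) < v i := fun i => by exact_mod_cast hv0 i
  have hrp : (0 : ℝ) < r := by exact_mod_cast (by omega : 0 < r)
  have hU : 0 < ∏ i ∈ range k, (v i : ℝ) := prod_pos fun i _ => hvp i
  have hP : 0 < ∏ i ∈ range k, (x i : ℝ) := prod_pos fun i _ => hxp i
  have hvk : (v k : ℝ) = r * (∏ i ∈ range k, (v i : ℝ)) + 1 := by
    have := hv k
    exact_mod_cast this
  have hmain := aux_main r hr v hv0 hv x hx hmono m k
  have hdef := aux_def r m x hx k
  have hS : 0 ≤ ∑ i ∈ range k, (r : ℝ) / x i := sum_nonneg fun i _ => (div_pos hrp (hxp _)).le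
  have hpos' : 0 < s → (s : ℝ) < r * ∏ i ∈ range k, (x i : ℝ) := fun h => by
    exact_mod_cast hpos h
  rw [sum_range_succ, prod_range_succ] at heq
  have hxk := hxp k
  generalize (∑ i ∈ range k, (r : ℝ) / x i) = S at *
  generalize (∏ i ∈ range k, (x i : ℝ)) = P at *
  generalize (∏ i ∈ range k, (v i : ℝ)) = U at *
  -- key identity
  have hkey : (m - S) * (P * x k) = r * P - s := by
    rw [← heq]; field_simp; ring
  have hnum : 0 < (r : ℝ) * P - s := by
    rcases lt_or_gt_of_ne hs with h | h
    · have : (s : ℝ) < 0 := by exact_mod_cast h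
      have := mul_pos hrp hP
      linarith
    · linarith [hpos' h]
  have hdpos : 0 < (m : ℝ) - S := by
    rw [← hkey] at hnum
    exact (pos_iff_pos_of_mul_pos hnum).2 (mul_pos hP hxk)
  have hm1 := hmain (by linarith)
  have hd1 := hdef (by linarith)
  rw [div_le_iff₀ hU] at hm1
  refine ⟨?_, ?_⟩
  · have : (0 : ℝ) < m := by linarith
    have : 0 < m := by exact_mod_cast this
    omega
  -- x k * P ≤ (r P - s) U
  have hA : P * x k ≤ (r * P - s) * U := by
    rw [← hkey]
    have := mul_le_mul_of_nonneg_left hm1 (mul_pos hP hxk).le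
    linarith
  have hB : (x k : ℝ) ≤ r * P - s := by
    rw [← hkey]
    have := mul_le_mul_of_nonneg_left hd1 hxk.le
    linarith
  split_ifs with h
  · have hsp : (0 : ℝ) < s := by exact_mod_cast h
    have h1 : P * x k < P * (r * U) := by nlinarith [mul_pos hsp hU]
    have h2 : (x k : ℝ) < r * U := lt_of_mul_lt_mul_left h1 hP.le
    have h3 : (x k : ℝ) < ((v k - 1 : ℤ) : ℝ) := by push_cast; linarith
    have h4 : x k < v k - 1 := by exact_mod_cast h3
    omega
  · have hsn : s < 0 := by omega
    have hsn' : (s : ℝ) < 0 := by exact_mod_cast hsn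
    rw [abs_of_neg hsn]
    have h2 : (x k : ℝ) ≤ r * U - s := by
      rcases le_total P U with hPU | hPU
      · nlinarith
      · have h1 : P * x k ≤ P * (r * U - s) := by nlinarith
        exact le_of_mul_le_mul_left h1 hP
    have h3 : (x k : ℝ) ≤ ((v k + -s - 1 : ℤ) : ℝ) := by push_cast; linarith
    exact_mod_cast h3

lemma aux_fin (r s : ℤ) (hr : 1 ≤ r) (hs : s ≠ 0) (n : ℕ) (hn : 2 ≤ n)
    (u : ℕ → ℤ) (hu1 : u 1 = r + 1)
    (hu : ∀ k, 1 ≤ k → u (k + 1) = r * (∏ i ∈ Finset.Icc 1 k, u i) + 1)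
    (q : Fin n → ℤ) (m : ℤ) (hq : ∀ i, 1 ≤ q i) (hmono : ∀ i j : Fin n, i ≤ j → q i ≤ q j)
    (heq : (r : ℚ) * (∑ i, ((q i : ℚ))⁻¹) - (s : ℚ) / (∏ i, (q i : ℚ)) = (m : ℚ))
    (hpos : 0 < s → s < r * ∏ k ∈ Finset.univ.erase (⟨n - 1, by omega⟩ : Fin n), q k) :
    1 ≤ m ∧ ∀ i, q i ≤ (if 0 < s then u n - 2 else u n + |s| - 1) := by
  obtain ⟨k, rfl⟩ : ∃ k, n = k + 1 := ⟨n - 1, by omega⟩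
  have hv : ∀ k, u (k + 1) = r * (∏ i ∈ range k, u (i + 1)) + 1 := by
    intro k
    rcases Nat.eq_zero_or_pos k with rfl | hk
    · simp [hu1]
    · rw [hu k hk]
      congr 2
      have h : Finset.Icc 1 k = Finset.Ico 1 (k + 1) := by ext; simp [Nat.lt_succ_iff]
      rw [h, Finset.prod_Ico_eq_prod_range]
      exact prod_congr (by simp) fun i _ => by rw [add_comm]
  have hv0 : ∀ k, 0 < u (k + 1) := by
    intro k
    induction k using Nat.strong_induction_on with
    | _ k ih =>
      rw [hv]
      have : 0 < ∏ i ∈ range k, u (i + 1) := prod_pos fun i hi => ih i (by simpa using hi)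
      nlinarith
  let x : ℕ → ℤ := fun i => q ⟨min i k, by omega⟩
  have hxq : ∀ i : Fin (k + 1), x i = q i := fun i => by
    simp only [x]; congr 1; ext; simp; omega
  have hxm : Monotone x := fun a b hab => hmono _ _ (by simp [Fin.le_def]; omega)
  have hprod : ∏ i ∈ univ.erase (Fin.last k), q i = ∏ i ∈ range k, x i := by
    have h1 : (∏ i ∈ univ.erase (Fin.last k), q i) * q (Fin.last k) = ∏ i, q i :=
      prod_erase_mul _ _ (mem_univ _)
    rw [Fin.prod_univ_castSucc] at h1
    have h2 : q (Fin.last k) ≠ 0 := by have := hq (Fin.last k); omega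
    rw [mul_right_cancel₀ h2 h1, prod_range]
    refine prod_congr rfl fun i _ => ?_
    rw [← hxq]; rfl
  have heq' : ∑ i ∈ range (k + 1), (r : ℝ) / x i - s / ∏ i ∈ range (k + 1), (x i : ℝ) = m := by
    rw [sum_range, prod_range]
    simp only [hxq]
    have := congrArg (fun t : ℚ => (t : ℝ)) heq
    push_cast at this
    rw [← this, mul_sum]
    simp only [div_eq_mul_inv]
  have hb := aux_bound r s hr hs (fun i => u (i + 1)) hv0 hv x (fun i => hq _) hxm m k heq'
    (fun h => by rw [← hprod]; exact hpos h)
  refine ⟨hb.1, fun i => le_trans ?_ hb.2⟩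
  rw [← hxq]
  exact hxm (by omega)

/-- **Theorem 3.1, parts.** Finiteness of ordered positive
solutions `(q_1 ≤ ⋯ ≤ q_n, m)` of `r(1/q_1 + ⋯ + 1/q_n) - s/(q_1 ⋯ q_n) = m`
under the side conditions `r q_1 ⋯ q_{n-1} > s` (when `s > 0`) and
`q_n > |s|` (when `s < 0`); moreover every solution has `m ≥ 1` and satisfies
`max q_i ≤ u_n(r) - 2` if `s > 0` and `max q_i ≤ u_n(r) + |s| - 1` if `s < 0`. -/
theorem positive_solutions_finite_and_bound
    (r s : ℤ) (hr : 1 ≤ r) (hs : s ≠ 0) (hrs : Int.gcd r s = 1)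
    (n : ℕ) (hn : 2 ≤ n)
    (u : ℕ → ℤ) (hu1 : u 1 = r + 1)
    (hu : ∀ k, 1 ≤ k → u (k + 1) = r * (∏ i ∈ Finset.Icc 1 k, u i) + 1) :
    {qm : (Fin n → ℤ) × ℤ |
        (∀ i, 1 ≤ qm.1 i) ∧
        (∀ i j : Fin n, i ≤ j → qm.1 i ≤ qm.1 j) ∧
        ((r : ℚ) * (∑ i, ((qm.1 i : ℚ))⁻¹) - (s : ℚ) / (∏ i, (qm.1 i : ℚ))
          = (qm.2 : ℚ)) ∧
        (0 < s → s < r * ∏ k ∈ Finset.univ.erase (⟨n - 1, by omega⟩ : Fin n), qm.1 k) ∧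
        (s < 0 → |s| < qm.1 (⟨n - 1, by omega⟩ : Fin n))}.Finite ∧
    ∀ q : Fin n → ℤ, ∀ m : ℤ,
      (∀ i, 1 ≤ q i) →
      (∀ i j : Fin n, i ≤ j → q i ≤ q j) →
      ((r : ℚ) * (∑ i, ((q i : ℚ))⁻¹) - (s : ℚ) / (∏ i, (q i : ℚ)) = (m : ℚ)) →
      (0 < s → s < r * ∏ k ∈ Finset.univ.erase (⟨n - 1, by omega⟩ : Fin n), q k) →
      (s < 0 → |s| < q (⟨n - 1, by omega⟩ : Fin n)) →
      1 ≤ m ∧ ∀ i, q i ≤ (if 0 < s then u n - 2 else u n + |s| - 1) := by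
  have key := aux_fin r s hr hs n hn u hu1 hu
  refine ⟨?_, fun q m h1 h2 h3 h4 _ => key q m h1 h2 h3 h4⟩
  apply Set.Finite.of_finite_image (f := Prod.fst)
  · refine (Set.finite_Icc (fun _ : Fin n => (1 : ℤ))
      (fun _ => if 0 < s then u n - 2 else u n + |s| - 1)).subset ?_
    rintro _ ⟨⟨q, m⟩, ⟨h1, h2, h3, h4, _⟩, rfl⟩
    exact ⟨fun i => h1 i, fun i => (key q m h1 h2 h3 h4).2 i⟩
  · rintro ⟨q, m⟩ ⟨_, _, h3, _⟩ ⟨q', m'⟩ ⟨_, _, h3', _⟩ h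
    simp only at h h3 h3'
    subst h
    rw [h3] at h3'
    have : m = m' := by exact_mod_cast h3'
    rw [this]
end

section
/- Let r and s be nonzero integers with r ≥ 1 and gcd(r, s) = 1, and let n ≥ 2. Suppose positive integers 1 ≤ q_1 ≤ q_2 ≤ ⋯ ≤ q_n and an integer m satisfy r·(1/q_1 + ⋯ + 1/q_n) − s/(q_1·q_2⋯q_n) = m, with r·q_1⋯q_{n−1} > s when s > 0 and q_n > |s| when s < 0. If additionally q_n > s², then q_n ≤ u_n(r) − s − 1. -/
open Finset

def UZ (r : ℤ) : ℕ → ℤ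
  | 0 => 1
  | k + 1 => UZ r k * (r * UZ r k + 1)

lemma UZ_pos (r : ℤ) (hr : 1 ≤ r) (k : ℕ) : 1 ≤ UZ r k := by
  induction k with
  | zero => simp [UZ]
  | succ k ih => simp only [UZ]; nlinarith [mul_nonneg (by linarith : (0:ℤ) ≤ r) (by linarith : 0 ≤ UZ r k)]

lemma UZ_mono (r : ℤ) (hr : 1 ≤ r) : Monotone (UZ r) := by
  apply monotone_nat_of_le_succ
  intro k
  have h := UZ_pos r hr k
  simp only [UZ]
  nlinarith [mul_nonneg (by linarith : (0:ℤ) ≤ r) (by linarith : 0 ≤ UZ r k)]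

lemma sum_UZ (r : ℤ) (hr : 1 ≤ r) (k : ℕ) :
    (r : ℝ) * ∑ i ∈ range k, 1 / ((r : ℝ) * UZ r i + 1) = 1 - 1 / (UZ r k : ℝ) := by
  induction k with
  | zero => simp [UZ]
  | succ k ih =>
    rw [sum_range_succ, mul_add, ih]
    have h : (1:ℝ) ≤ UZ r k := by exact_mod_cast UZ_pos r hr k
    have hr' : (1:ℝ) ≤ r := by exact_mod_cast hr
    have : (0:ℝ) < r * UZ r k + 1 := by positivity
    simp only [UZ]
    push_cast
    field_simp
    ring

lemma maj (x t : ℕ → ℝ) (hx : Antitone x) (hx0 : ∀ i, 0 < x i) (ht : ∀ i, 0 < t i)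
    (k N : ℕ) (hL : ∀ j, k ≤ j → j ≤ N → ∑ i ∈ range k, Real.log (t i) ≤ ∑ i ∈ range j, Real.log (t i))
    (j : ℕ) (hkj : k ≤ j) : j ≤ N →
    x j * (∑ i ∈ range j, Real.log (t i) - ∑ i ∈ range k, Real.log (t i)) ≤
      ∑ i ∈ range j, x i * (t i - 1) - ∑ i ∈ range k, x i * (t i - 1) := by
  induction j, hkj using Nat.le_induction with
  | base => intro _; simp
  | succ j hkj ih =>
    intro hj
    have h1 := ih (by omega)
    have h2 := hL (j+1) (by omega) hj
    have h3 := Real.log_le_sub_one_of_pos (ht j)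
    have h4 := hx (Nat.le_succ j)
    have h5 := mul_le_mul_of_nonneg_left h3 (hx0 j).le
    have h6 := mul_le_mul_of_nonneg_right h4 (sub_nonneg.2 h2)
    rw [Nat.succ_eq_add_one] at h6
    refine h6.trans ?_
    rw [sum_range_succ, sum_range_succ]
    linarith

lemma maj_rigid (x t : ℕ → ℝ) (hx : Antitone x) (hx0 : ∀ i, 0 < x i) (ht : ∀ i, 0 < t i)
    (k N : ℕ) (hL : ∀ j, k ≤ j → j ≤ N → ∑ i ∈ range k, Real.log (t i) ≤ ∑ i ∈ range j, Real.log (t i))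
    (j : ℕ) (hkj : k ≤ j) : j ≤ N →
      ∑ i ∈ range j, x i * (t i - 1) - ∑ i ∈ range k, x i * (t i - 1) ≤ 0 →
      ∀ i, k ≤ i → i < j → t i = 1 := by
  induction j, hkj using Nat.le_induction with
  | base => intro _ _ i h1 h2; omega
  | succ j hkj ih =>
    intro hj hle
    have h1 := maj x t hx hx0 ht k N hL j hkj (by omega)
    have h2 := hL (j+1) (by omega) hj
    have h0 := hL j (by omega) (by omega)
    rw [sum_range_succ] at hle h2
    have h7 : t j = 1 := by
      by_contra hne
      have h3 := Real.log_lt_sub_one_of_pos (ht j) hne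
      have h5 := mul_lt_mul_of_pos_left h3 (hx0 j)
      have h6 := mul_nonneg (hx0 j).le (sub_nonneg.2 h2)
      linarith
    rw [h7] at hle
    intro i hi hij
    rcases Nat.lt_succ_iff_lt_or_eq.1 hij with h | h
    · exact ih (by omega) (by linarith) i hi h
    · rw [h]; exact h7

noncomputable def dl (r m : ℤ) (q : ℕ → ℤ) (k : ℕ) : ℝ := m - r * ∑ i ∈ range k, 1 / (q i : ℝ)

def Gap (r m : ℤ) (q : ℕ → ℤ) (k : ℕ) : Prop :=
  (m = 1 ∧ ∀ i < k, q i = r * UZ r i + 1) ∨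
    1 / (UZ r k : ℝ) + 1 / (UZ r (k+1) : ℝ) ≤ dl r m q k

lemma keyM (r m : ℤ) (hr : 1 ≤ r) (q : ℕ → ℤ) (hq : Monotone q) (hq1 : ∀ i, 1 ≤ q i)
    (M : ℕ) (IH : ∀ k ≤ M, Gap r m q k) (c : ℝ)
    (hc : (r : ℝ) * UZ r M + 1 ≤ c) (hP : (UZ r M : ℝ) * c ≤ ∏ i ∈ range (M+1), (q i : ℝ)) :
    2 / (UZ r (M+1) : ℝ) ≤ dl r m q (M+1) ∨
    (1 / (UZ r M : ℝ) - r / c ≤ dl r m q (M+1) ∧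
      (dl r m q (M+1) ≤ 1 / (UZ r M : ℝ) - r / c →
        m = 1 ∧ (∀ i < M, q i = r * UZ r i + 1) ∧ (q M : ℝ) = c)) := by
  have hr' : (1:ℝ) ≤ r := by exact_mod_cast hr
  have hU : ∀ k, (1:ℝ) ≤ UZ r k := fun k => by exact_mod_cast UZ_pos r hr k
  have hq' : ∀ k, (1:ℝ) ≤ q k := fun k => by exact_mod_cast hq1 k
  have hq0 : ∀ k, (0:ℝ) < q k := fun k => by linarith [hq' k]
  have ha : ∀ k, (0:ℝ) < r * UZ r k + 1 := fun k => by have := hU k; positivity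
  have hc0 : 0 < c := lt_of_lt_of_le (ha M) hc
  obtain ⟨b, hb⟩ : ∃ b : ℕ → ℝ, b = fun i => if i < M then (r : ℝ) * UZ r i + 1 else c := ⟨_, rfl⟩
  have hbM : b M = c := by simp [hb]
  have hbi : ∀ i < M, b i = (r : ℝ) * UZ r i + 1 := fun i hi => by simp [hb, hi]
  have hb0 : ∀ i, 0 < b i := by
    intro i; rw [hb]; dsimp only; split_ifs
    · exact ha i
    · exact hc0
  have hbs : ∀ k ≤ M, (r:ℝ) * ∑ i ∈ range k, 1 / b i = 1 - 1 / (UZ r k : ℝ) := by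
    intro k hk
    rw [← sum_UZ r hr k]
    congr 1
    apply sum_congr rfl
    intro i hi
    rw [hbi i (by have := mem_range.1 hi; omega)]
  have hbp : ∀ k ≤ M, ∏ i ∈ range k, b i = (UZ r k : ℝ) := by
    intro k
    induction k with
    | zero => intro _; simp [UZ]
    | succ k ih =>
      intro hk
      rw [prod_range_succ, ih (by omega), hbi k (by omega)]
      simp [UZ]
  let x : ℕ → ℝ := fun i => 1 / (q i : ℝ)
  let t : ℕ → ℝ := fun i => (q i : ℝ) / b i
  have hx : Antitone x := by
    intro i j hij
    have : (q i : ℝ) ≤ q j := by exact_mod_cast hq hij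
    exact one_div_le_one_div_of_le (hq0 i) this
  have hx0 : ∀ i, 0 < x i := fun i => by have := hq0 i; positivity
  have ht : ∀ i, 0 < t i := fun i => div_pos (hq0 i) (hb0 i)
  have hxt : ∀ i, x i * (t i - 1) = 1 / b i - 1 / (q i : ℝ) := by
    intro i
    have := hq0 i
    have := hb0 i
    simp only [x, t]
    field_simp
  obtain ⟨k, hkm, hkmin⟩ := exists_min_image (range (M+1))
    (fun j => ∑ i ∈ range j, Real.log (t i)) ⟨0, by simp⟩
  have hkM : k ≤ M := by have := mem_range.1 hkm; omega
  have hLN : 0 ≤ ∑ i ∈ range (M+1), Real.log (t i) := by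
    rw [← Real.log_prod (fun i _ => (ht i).ne')]
    apply Real.log_nonneg
    simp only [t]
    rw [prod_div_distrib, le_div_iff₀ (prod_pos fun i _ => hb0 i), one_mul, prod_range_succ b, hbp M le_rfl, hbM]
    exact hP
  have hL : ∀ j, k ≤ j → j ≤ M+1 → ∑ i ∈ range k, Real.log (t i) ≤ ∑ i ∈ range j, Real.log (t i) := by
    intro j _ hj
    rcases Nat.lt_or_ge j (M+1) with h | h
    · exact hkmin j (mem_range.2 h)
    · have : j = M+1 := by omega
      rw [this]
      have := hkmin 0 (by simp)
      simp only [range_zero, sum_empty] at this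
      linarith
  have h1 := maj x t hx hx0 ht k (M+1) hL (M+1) (by omega) le_rfl
  have h2 := maj_rigid x t hx hx0 ht k (M+1) hL (M+1) (by omega) le_rfl
  have h1' := le_trans (mul_nonneg (hx0 (M+1)).le (sub_nonneg.2 (hL (M+1) (by omega) le_rfl))) h1
  simp only [hxt, sum_sub_distrib] at h1' h2
  have hk := hbs k hkM
  have hN : (r:ℝ) * ∑ i ∈ range (M+1), 1 / b i = 1 - 1 / (UZ r M : ℝ) + r / c := by
    rw [sum_range_succ, mul_add, hbs M le_rfl, hbM]; ring
  have h3 := mul_nonneg (by linarith : (0:ℝ) ≤ r) h1'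
  have hU1 : 1 / (UZ r (M+1) : ℝ) = 1 / UZ r M - r / (r * UZ r M + 1) := by
    have := ha M
    have := hU M
    simp only [UZ]; push_cast; field_simp; ring
  have h4 : (r:ℝ) / c ≤ r / (r * UZ r M + 1) :=
    div_le_div_of_nonneg_left (by linarith) (ha M) hc
  rcases IH k hkM with ⟨hm, he⟩ | hg
  · right
    have he' : ∑ i ∈ range k, 1 / (q i : ℝ) = ∑ i ∈ range k, 1 / b i := by
      apply sum_congr rfl
      intro i hi
      have := mem_range.1 hi
      rw [hbi i (by omega), he i this]; push_cast; rfl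
    rw [he'] at h3 h2
    subst hm
    simp only [dl]
    push_cast
    constructor
    · nlinarith
    · intro hle
      have h5 := h2 (by
        by_contra hcon
        push Not at hcon
        have := mul_pos (by linarith : (0:ℝ) < r) hcon
        nlinarith)
      have h6 : ∀ i, k ≤ i → i < M+1 → (q i : ℝ) = b i := by
        intro i h7 h8
        have := h5 i h7 h8
        simp only [t] at this
        rwa [div_eq_one_iff_eq (hb0 i).ne'] at this
      refine ⟨trivial, ?_, ?_⟩
      · intro i hi
        rcases Nat.lt_or_ge i k with h | h
        · exact he i h
        · have := h6 i h (by omega)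
          rw [hbi i hi] at this
          exact_mod_cast this
      · rw [h6 M hkM (by omega), hbM]
  · left
    have h5 : 1 / (UZ r (M+1) : ℝ) ≤ 1 / (UZ r (k+1) : ℝ) := by
      apply one_div_le_one_div_of_le (by linarith [hU (k+1)])
      exact_mod_cast UZ_mono r hr (by omega : k+1 ≤ M+1)
    simp only [dl] at hg ⊢
    have : 2 / (UZ r (M+1) : ℝ) = 1 / (UZ r (M+1) : ℝ) + 1 / (UZ r (M+1) : ℝ) := by ring
    rw [this]
    nlinarith

/-- integrality -/
lemma dl_int (r m : ℤ) (q : ℕ → ℤ) (hq1 : ∀ i, 1 ≤ q i) (k : ℕ) :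
    ∃ d : ℤ, dl r m q k * (∏ i ∈ range k, q i : ℤ) = d := by
  induction k with
  | zero => exact ⟨m, by simp [dl]⟩
  | succ k ih =>
    obtain ⟨d, hd⟩ := ih
    refine ⟨d * q k - r * ∏ i ∈ range k, q i, ?_⟩
    have : (0:ℝ) < q k := by exact_mod_cast (by linarith [hq1 k] : 0 < q k)
    have h : dl r m q (k+1) = dl r m q k - r / q k := by
      simp only [dl, sum_range_succ]; ring
    rw [h, prod_range_succ]
    push_cast at hd ⊢
    rw [← hd]
    field_simp

lemma dl_anti (r m : ℤ) (hr : 1 ≤ r) (q : ℕ → ℤ) (hq1 : ∀ i, 1 ≤ q i) : Antitone (dl r m q) := by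
  apply antitone_nat_of_succ_le
  intro k
  have h : dl r m q (k+1) = dl r m q k - r / q k := by
    simp only [dl, sum_range_succ]; ring
  have h1 : (0:ℝ) < q k := by exact_mod_cast (by linarith [hq1 k] : 0 < q k)
  have h2 : (0:ℝ) < r := by exact_mod_cast (by linarith : 0 < r)
  have := div_pos h2 h1
  linarith

lemma gap_all (r m : ℤ) (hr : 1 ≤ r) (q : ℕ → ℤ) (hq : Monotone q) (hq1 : ∀ i, 1 ≤ q i)
    (k : ℕ) : 0 < dl r m q k → Gap r m q k := by
  induction k using Nat.strong_induction_on with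
  | _ k ih =>
  intro hpos
  have hr' : (1:ℝ) ≤ r := by exact_mod_cast hr
  rcases k with _ | M
  · simp only [dl, range_zero, sum_empty, mul_zero, sub_zero] at hpos
    have hm : 0 < m := by exact_mod_cast hpos
    rcases eq_or_ne m 1 with h | h
    · left; exact ⟨h, by omega⟩
    · right
      have : (2:ℝ) ≤ m := by exact_mod_cast (by omega : 2 ≤ m)
      simp only [dl, UZ, range_zero, sum_empty]
      push_cast
      have h1 : 1 / (1 * ((r:ℝ) * 1 + 1)) ≤ 1 := by
        rw [div_le_one (by linarith)]; linarith
      linarith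
  · have IH : ∀ k ≤ M, Gap r m q k := fun k hk =>
      ih k (by omega) (lt_of_lt_of_le hpos (dl_anti r m hr q hq1 (by omega)))
    by_contra hcon
    have hcon2 : ¬ (1 / (UZ r (M+1) : ℝ) + 1 / (UZ r (M+1+1) : ℝ) ≤ dl r m q (M+1)) :=
      fun h => hcon (Or.inr h)
    push Not at hcon2
    obtain ⟨d, hd⟩ := dl_int r m q hq1 (M+1)
    obtain ⟨P, hPdef⟩ : ∃ P : ℤ, P = ∏ i ∈ range (M+1), q i := ⟨_, rfl⟩
    rw [← hPdef] at hd
    have hP0 : 0 < P := by rw [hPdef]; exact prod_pos fun i _ => by linarith [hq1 i]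
    have hP0' : (0:ℝ) < P := by exact_mod_cast hP0
    have hd0 : 1 ≤ d := by
      have : (0:ℝ) < d := by rw [← hd]; positivity
      exact_mod_cast this
    have hd0' : (1:ℝ) ≤ d := by exact_mod_cast hd0
    have hV : (1:ℝ) ≤ UZ r M := by exact_mod_cast UZ_pos r hr M
    obtain ⟨U, hU⟩ : ∃ U : ℤ, U = UZ r (M+1) := ⟨_, rfl⟩
    have hUr : (U : ℝ) = UZ r M * (r * UZ r M + 1) := by rw [hU]; simp [UZ]
    have hU1 : (1:ℝ) ≤ U := by rw [hU]; exact_mod_cast UZ_pos r hr (M+1)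
    have hU2 : (UZ r (M+1+1) : ℝ) = U * (r * U + 1) := by rw [hU]; simp [UZ]
    have hrU : (1:ℝ) ≤ r * U := by nlinarith
    have hUP : U ≤ P := by
      by_contra hlt
      have h1 : (P:ℝ) ≤ U - 1 := by exact_mod_cast (by omega : P ≤ U - 1)
      rw [hU2, ← hU] at hcon2
      have h2 : 1 ≤ dl r m q (M+1) * (U - 1) := by nlinarith
      have h3 : (1 / (U:ℝ) + 1 / (U * (r * U + 1))) * (U-1) < 1 := by
        have : (1 / (U:ℝ) + 1 / (U * (r * U + 1))) * (U-1) = (r*U+2)*(U-1) / (U * (r * U + 1)) := by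
          field_simp; ring
        rw [this, div_lt_one (by positivity)]
        nlinarith
      have h4 := mul_le_mul_of_nonneg_right hcon2.le (by linarith : (0:ℝ) ≤ U - 1)
      linarith
    have hlt2 : dl r m q (M+1) < 2 / U := by
      rw [hU2, ← hU] at hcon2
      have : 1 / ((U:ℝ) * (r * U + 1)) ≤ 1 / U :=
        one_div_le_one_div_of_le (by linarith) (by nlinarith)
      have h2 : 2 / (U:ℝ) = 1 / U + 1 / U := by ring
      linarith
    have hPr : ∏ i ∈ range (M+1), (q i : ℝ) = P := by rw [hPdef]; push_cast; rfl
    rcases eq_or_lt_of_le hUP with hEq | hLt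
    · have hd1 : d = 1 := by
        by_contra hne
        have : (2:ℝ) ≤ d := by exact_mod_cast (by omega : 2 ≤ d)
        rw [lt_div_iff₀ (by linarith)] at hlt2
        rw [← hEq] at hd
        linarith
      have hdl : dl r m q (M+1) = 1 / U := by
        rw [eq_div_iff (by linarith), hEq, hd, hd1]; simp
      rcases keyM r m hr q hq hq1 M IH (r * UZ r M + 1) le_rfl
        (by rw [hPr, ← hEq, hUr]) with h | ⟨_, h⟩
      · rw [← hU] at h; linarith
      · have := h (by
          rw [hdl, hUr]
          apply le_of_eq
          have : (0:ℝ) < r * UZ r M + 1 := by positivity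
          field_simp; ring)
        obtain ⟨hm, h1, h2⟩ := this
        apply hcon
        left
        refine ⟨hm, fun i hi => ?_⟩
        rcases Nat.lt_succ_iff_lt_or_eq.1 hi with h | h
        · exact h1 i h
        · rw [h]; exact_mod_cast h2
    · have hLt' : (U:ℝ) + 1 ≤ P := by exact_mod_cast hLt
      have hV0 : (0:ℝ) < UZ r M := by linarith
      have hc : (UZ r M : ℝ) * (((U:ℝ)+1) / UZ r M) = U + 1 := by field_simp
      rcases keyM r m hr q hq hq1 M IH (((U:ℝ)+1) / UZ r M)
        (by rw [le_div_iff₀ hV0, hUr]; linarith)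
        (by rw [hPr, hc]; exact hLt') with h | ⟨h, _⟩
      · rw [← hU] at h; linarith
      · rw [hU2, ← hU] at hcon2
        have h1 : 1 / (UZ r M : ℝ) - r / (((U:ℝ)+1) / UZ r M) = 1 / U + r * UZ r M / (U * (U+1)) := by
          rw [hUr]
          have : (0:ℝ) < r * UZ r M + 1 := by positivity
          field_simp; ring
        have h2 : 1 / ((U:ℝ) * (r * U + 1)) ≤ r * UZ r M / (U * (U+1)) := by
          rw [div_le_div_iff₀ (by positivity) (by positivity)]
          have h3 : (1:ℝ) ≤ r * UZ r M := by nlinarith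
          have h4 : (U:ℝ) + 1 ≤ r * U + 1 := by nlinarith
          have h5 : (U:ℝ) * (U + 1) ≤ U * (r * U + 1) := mul_le_mul_of_nonneg_left h4 (by linarith)
          have h6 : 0 ≤ (U:ℝ) * (r * U + 1) := by positivity
          nlinarith
        linarith

lemma final_bounds (r m : ℤ) (hr : 1 ≤ r) (q : ℕ → ℤ) (hq : Monotone q) (hq1 : ∀ i, 1 ≤ q i)
    (M : ℕ) (d P : ℤ) (hP : P = ∏ i ∈ range (M+1), q i) (hd : dl r m q (M+1) * P = d) (hd0 : 1 ≤ d) :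
    P ≤ d * UZ r (M+1) ∧ (2 ≤ d → 2 * P ≤ d * (UZ r (M+1) + UZ r M)) := by
  have hr' : (1:ℝ) ≤ r := by exact_mod_cast hr
  have hP0 : 0 < P := by rw [hP]; exact prod_pos fun i _ => by linarith [hq1 i]
  have hP0' : (0:ℝ) < P := by exact_mod_cast hP0
  have hd0' : (1:ℝ) ≤ d := by exact_mod_cast hd0
  have hpos : 0 < dl r m q (M+1) := by
    by_contra h
    push Not at h
    nlinarith
  have hV : (1:ℝ) ≤ UZ r M := by exact_mod_cast UZ_pos r hr M
  have hU1 : (1:ℝ) ≤ UZ r (M+1) := by exact_mod_cast UZ_pos r hr (M+1)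
  have hUr : (UZ r (M+1) : ℝ) = UZ r M * (r * UZ r M + 1) := by simp [UZ]
  have hPr : ∏ i ∈ range (M+1), (q i : ℝ) = P := by rw [hP]; push_cast; rfl
  have hge : 1 / (UZ r (M+1) : ℝ) ≤ dl r m q (M+1) := by
    rcases gap_all r m hr q hq hq1 (M+1) hpos with ⟨hm, he⟩ | h
    · have := sum_UZ r hr (M+1)
      simp only [dl]
      have h2 : ∑ i ∈ range (M+1), 1 / (q i : ℝ) = ∑ i ∈ range (M+1), 1 / ((r:ℝ) * UZ r i + 1) := by
        apply sum_congr rfl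
        intro i hi
        rw [he i (mem_range.1 hi)]; push_cast; rfl
      rw [h2, this, hm]; simp
    · have : (1:ℝ) ≤ UZ r (M+1+1) := by exact_mod_cast UZ_pos r hr (M+1+1)
      have : 0 < 1 / (UZ r (M+1+1) : ℝ) := by positivity
      linarith
  constructor
  · rw [div_le_iff₀ (by linarith)] at hge
    have : (P:ℝ) ≤ d * UZ r (M+1) := by
      rw [← hd]; nlinarith
    exact_mod_cast this
  · intro hd2
    have hd2' : (2:ℝ) ≤ d := by exact_mod_cast hd2
    by_contra hlt
    push Not at hlt
    have hlt' : (d:ℝ) * (UZ r (M+1) + UZ r M) < 2 * P := by exact_mod_cast hlt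
    have hPP : (UZ r (M+1) : ℝ) + UZ r M ≤ P := by nlinarith
    have key : 2 / ((UZ r (M+1) : ℝ) + UZ r M) ≤ dl r m q (M+1) := by
      have IH : ∀ k ≤ M, Gap r m q k := fun k hk =>
        gap_all r m hr q hq hq1 k (lt_of_lt_of_le hpos (dl_anti r m hr q hq1 (by omega)))
      rcases keyM r m hr q hq hq1 M IH (r * UZ r M + 2) (by linarith)
        (by rw [hPr]; rw [hUr] at hPP; linarith) with h | ⟨h, _⟩
      · refine le_trans ?_ h
        exact div_le_div_of_nonneg_left (by norm_num) (by linarith) (by linarith)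
      · refine le_trans (le_of_eq ?_) h
        rw [hUr]
        have : (0:ℝ) < r * UZ r M + 2 := by positivity
        have : (0:ℝ) < r * UZ r M + 1 := by positivity
        have e : (UZ r M : ℝ) * (r * UZ r M + 1) + UZ r M = UZ r M * (r * UZ r M + 2) := by ring
        rw [e]
        field_simp; ring
    rw [div_le_iff₀ (by linarith)] at key
    have := mul_le_mul_of_nonneg_right key hP0'.le
    rw [← hd] at hlt'
    linarith

/-- **Theorem 3.1(2).** Under the hypotheses of the finiteness
theorem, if additionally `q_n > s²` then `q_n ≤ u_n(r) - s - 1`. -/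
theorem positive_solutions_sharp_bound
    (r s : ℤ) (hr : 1 ≤ r) (hs : s ≠ 0) (hrs : Int.gcd r s = 1)
    (n : ℕ) (hn : 2 ≤ n)
    (u : ℕ → ℤ) (hu1 : u 1 = r + 1)
    (hu : ∀ k, 1 ≤ k → u (k + 1) = r * (∏ i ∈ Finset.Icc 1 k, u i) + 1)
    (q : Fin n → ℤ) (m : ℤ)
    (hq1 : ∀ i, 1 ≤ q i)
    (hmono : ∀ i j : Fin n, i ≤ j → q i ≤ q j)
    (heq : (r : ℚ) * (∑ i, ((q i : ℚ))⁻¹) - (s : ℚ) / (∏ i, (q i : ℚ)) = (m : ℚ))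
    (hside₁ : 0 < s → s < r * ∏ k ∈ Finset.univ.erase (⟨n - 1, by omega⟩ : Fin n), q k)
    (hside₂ : s < 0 → |s| < q (⟨n - 1, by omega⟩ : Fin n))
    (hbig : s ^ 2 < q (⟨n - 1, by omega⟩ : Fin n)) :
    q (⟨n - 1, by omega⟩ : Fin n) ≤ u n - s - 1 := by
  obtain ⟨M, rfl⟩ : ∃ M, n = M + 1 + 1 := ⟨n - 2, by omega⟩
  have hlast : (⟨M + 1 + 1 - 1, by omega⟩ : Fin (M+1+1)) = Fin.last (M+1) := rfl
  rw [hlast] at hside₁ hside₂ hbig ⊢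
  -- the sequence
  have hprod : ∀ k, ∏ i ∈ Finset.Icc 1 k, u i = UZ r k := by
    intro k
    induction k with
    | zero => simp [UZ]
    | succ k ih =>
      rw [Finset.prod_Icc_succ_top (by omega), ih]
      rcases k with _ | k
      · simp [UZ, hu1]
      · rw [hu (k+1) (by omega), ih]; rfl
  have hun : u (M+1+1) = r * UZ r (M+1) + 1 := by rw [hu (M+1) (by omega), hprod]
  let p : ℕ → ℤ := fun i => q ⟨min i (M+1), by omega⟩
  have hp : Monotone p := by
    intro i j hij
    apply hmono
    simp only [Fin.mk_le_mk]
    omega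
  have hp1 : ∀ i, 1 ≤ p i := fun i => hq1 _
  have hpc : ∀ i : Fin (M+1), q i.castSucc = p i := by
    intro i
    simp only [p]
    congr 1
    ext
    simp
  obtain ⟨Q, hQ⟩ : ∃ Q, Q = q (Fin.last (M+1)) := ⟨_, rfl⟩
  obtain ⟨P, hP⟩ : ∃ P : ℤ, P = ∏ i ∈ range (M+1), p i := ⟨_, rfl⟩
  have hQ1 : 1 ≤ Q := by rw [hQ]; exact hq1 _
  have hP0 : 0 < P := by rw [hP]; exact prod_pos fun i _ => by linarith [hp1 i]
  have hprodq : ∏ i : Fin (M+1), q i.castSucc = P := by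
    rw [hP, ← Fin.prod_univ_eq_prod_range]
    exact Finset.prod_congr rfl fun i _ => hpc i
  have herase : ∏ k ∈ Finset.univ.erase (Fin.last (M+1)), q k = P := by
    have h1 := Finset.mul_prod_erase Finset.univ q (Finset.mem_univ (Fin.last (M+1)))
    rw [Fin.prod_univ_castSucc, hprodq, ← hQ, mul_comm P] at h1
    exact mul_left_cancel₀ (by omega) h1
  rw [herase] at hside₁
  obtain ⟨d, hd⟩ := dl_int r m p hp1 (M+1)
  rw [← hP] at hd
  have hdQ : d * Q = r * P - s := by
    have heq' : (r : ℝ) * (∑ i, ((q i : ℝ))⁻¹) - (s : ℝ) / (∏ i, (q i : ℝ)) = (m : ℝ) := by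
      have h9 := congrArg (fun z : ℚ => (z : ℝ)) heq
      push_cast at h9
      exact h9
    rw [Fin.sum_univ_castSucc, Fin.prod_univ_castSucc, ← hQ] at heq'
    have e1 : ∏ i : Fin (M+1), (q i.castSucc : ℝ) = P := by exact_mod_cast congrArg (fun z : ℤ => (z : ℝ)) hprodq
    have e2 : ∑ i : Fin (M+1), (q i.castSucc : ℝ)⁻¹ = ∑ i ∈ range (M+1), 1 / (p i : ℝ) := by
      rw [← Fin.sum_univ_eq_sum_range (fun i => 1 / (p i : ℝ))]
      exact Finset.sum_congr rfl fun i _ => by rw [hpc i, one_div]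
    rw [e1, e2] at heq'
    have hP0' : (0:ℝ) < P := by exact_mod_cast hP0
    have hQ0' : (0:ℝ) < Q := by exact_mod_cast hQ1
    have e3 : dl r m p (M+1) = r / Q - s / (P * Q) := by
      simp only [dl]
      rw [← heq']
      ring
    rw [e3] at hd
    have : (d : ℝ) * Q = r * P - s := by
      rw [← hd]; field_simp
    exact_mod_cast this
  rw [← hQ] at hside₂ hbig ⊢
  have hpos : 0 < r * P - s := by
    rcases lt_or_gt_of_ne hs with h | h
    · nlinarith
    · linarith [hside₁ h]
  have hd0 : 1 ≤ d := by
    by_contra h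
    have : d ≤ 0 := by omega
    nlinarith
  obtain ⟨b1, b2⟩ := final_bounds r m hr p hp hp1 M d P hP hd hd0
  rw [hun]
  have b1' := mul_le_mul_of_nonneg_left b1 (by linarith : 0 ≤ r)
  have hV := UZ_pos r hr M
  suffices h : Q ≤ r * UZ r (M+1) - s by linarith
  rcases lt_or_gt_of_ne hs with h | h
  · have : d * Q ≤ d * (r * UZ r (M+1) - s) := by nlinarith
    exact le_of_mul_le_mul_left this (by omega)
  · rcases eq_or_lt_of_le hd0 with h1 | h1
    · rw [← h1] at hdQ b1'; linarith
    · have b2' := mul_le_mul_of_nonneg_left (b2 h1) (by linarith : 0 ≤ r)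
      obtain ⟨x, hx⟩ : ∃ x, x = r * UZ r M := ⟨_, rfl⟩
      have hx1 : 1 ≤ x := by rw [hx]; nlinarith
      have hrU : r * UZ r (M+1) = x * (x + 1) := by rw [hx]; simp only [UZ]; ring
      have e : r * (d * (UZ r (M+1) + UZ r M)) = d * (x * (x + 2)) := by
        have : r * (d * (UZ r (M+1) + UZ r M)) = d * (r * UZ r (M+1) + r * UZ r M) := by ring
        rw [this, hrU, ← hx]; ring
      rw [e] at b2'
      have h2 : 2 * Q < x * (x + 2) := by
        have : d * (2 * Q) < d * (x * (x+2)) := by linarith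
        exact lt_of_mul_lt_mul_left this (by omega)
      rw [hrU]
      have h3 : s ≤ x - 1 := by
        by_contra hc
        have hc' : x ≤ s := by omega
        have : x * x ≤ s ^ 2 := by nlinarith
        have hx2 : x < 2 := by nlinarith
        have : x = 1 := by omega
        subst this
        nlinarith
      nlinarith [sq_nonneg (x - 1)]
end

section
/- Let s be a nonzero integer and n ≥ 2, and set M_n = 1 if n is even and M_n = 2 if n is odd. If gcd(s, M_n) = 1, then the equation 1/x_1 + ⋯ + 1/x_n = s/(x_1·x_2⋯x_n) has infinitely many solutions in nonzero integers (x_1, …, x_n) with at least two |x_i| ≥ 2 and gcd(x_1·x_2⋯x_n, s) = 1. If n is odd and s is even, then this equation has no solutions in nonzero integers with gcd(x_1·x_2⋯x_n, s) = 1. -/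
open Finset

/-- The set of solutions in the theorem. -/
def solSet (s : ℤ) (n : ℕ) : Set (Fin n → ℤ) :=
  {x : Fin n → ℤ |
          (∀ i, x i ≠ 0) ∧
          (∑ i, ((x i : ℚ))⁻¹) = (s : ℚ) / (∏ i, (x i : ℚ)) ∧
          (∃ i j, i ≠ j ∧ 2 ≤ |x i| ∧ 2 ≤ |x j|) ∧
          Int.gcd (∏ i, x i) s = 1}

lemma solSet_step (s : ℤ) (n : ℕ) (h : (solSet (-s) n).Infinite) :
    (solSet s (n + 2)).Infinite := by
  have hinj : Function.Injective
      (fun x : Fin n → ℤ => (Fin.cons 1 (Fin.cons (-1) x : Fin (n+1) → ℤ) : Fin (n+2) → ℤ)) := by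
    intro x y hxy
    exact Fin.cons_right_injective _ (Fin.cons_right_injective _ hxy)
  refine (h.image hinj.injOn).mono ?_
  rintro _ ⟨x, ⟨h0, h1, ⟨i, j, hij, hi, hj⟩, h3⟩, rfl⟩
  refine ⟨?_, ?_, ⟨i.succ.succ, j.succ.succ, ?_, ?_, ?_⟩, ?_⟩
  · intro i
    refine Fin.cases ?_ (fun i => ?_) i
    · simp
    · refine Fin.cases ?_ (fun i => ?_) i
      · simp
      · simpa using h0 i
  · simp only [Fin.sum_univ_succ, Fin.prod_univ_succ, Fin.cons_zero, Fin.cons_succ, h1]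
    push_cast
    rw [one_mul, neg_one_mul, div_neg, neg_div]
    norm_num
  · simpa using hij
  · simpa using hi
  · simpa using hj
  · simp only [Fin.prod_univ_succ, Fin.cons_zero, Fin.cons_succ]
    simpa using h3

lemma four_le (s : ℤ) (hs : s ≠ 0) (k : ℕ) : 4 ≤ |((k:ℤ) + 4) * s| := by
  have h1 : 1 ≤ |s| := Int.one_le_abs hs
  rw [abs_mul, abs_of_nonneg (by positivity)]
  nlinarith

lemma solSet_two (s : ℤ) (hs : s ≠ 0) : (solSet s 2).Infinite := by
  refine Set.infinite_of_injective_forall_mem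
    (f := fun k : ℕ => ![1 + ((k:ℤ) + 5) * s, -1 - ((k:ℤ) + 4) * s]) ?_ ?_
  · intro a b hab
    have := congrFun hab 0
    simp [hs] at this
    exact this
  · intro k
    have h4 := four_le s hs k
    have h5 := four_le s hs (k+1)
    push_cast at h5
    rw [show ((k:ℤ) + 1 + 4) = k + 5 by ring] at h5
    have ha : 2 ≤ |1 + ((k:ℤ) + 5) * s| := by
      rw [le_abs] at *
      omega
    have hb : 2 ≤ |-1 - ((k:ℤ) + 4) * s| := by
      rw [le_abs] at *
      omega
    have ha0 : 1 + ((k:ℤ) + 5) * s ≠ 0 := by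
      intro h
      simp [h] at ha
    have hb0 : -1 - ((k:ℤ) + 4) * s ≠ 0 := by
      intro h
      simp [h] at hb
    refine ⟨?_, ?_, ⟨0, 1, by simp, by simpa using ha, by simpa using hb⟩, ?_⟩
    · intro i
      fin_cases i
      · simpa using ha0
      · simpa using hb0
    · simp only [Fin.sum_univ_two, Fin.prod_univ_two, Matrix.cons_val_zero, Matrix.cons_val_one]
      have ha1 : ((1 + ((k:ℤ) + 5) * s : ℤ) : ℚ) ≠ 0 := by exact_mod_cast ha0
      have hb1 : ((-1 - ((k:ℤ) + 4) * s : ℤ) : ℚ) ≠ 0 := by exact_mod_cast hb0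
      rw [inv_add_inv ha1 hb1]
      congr 1
      push_cast
      ring
    · simp only [Fin.prod_univ_two, Matrix.cons_val_zero, Matrix.cons_val_one]
      rw [← Int.isCoprime_iff_gcd_eq_one]
      refine IsCoprime.mul_left ⟨1, -((k:ℤ)+5), by ring⟩ ⟨-1, -((k:ℤ)+4), by ring⟩

lemma solSet_three (s : ℤ) (hs : s ≠ 0) (hodd : Odd s) : (solSet s 3).Infinite := by
  refine Set.infinite_of_injective_forall_mem
    (f := fun k : ℕ => ![2 + ((k:ℤ) + 4) * s, -1 - ((k:ℤ) + 4) * s,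
      s + (2 + ((k:ℤ) + 4) * s) * (1 + ((k:ℤ) + 4) * s)]) ?_ ?_
  · intro a b hab
    have := congrFun hab 0
    simp [hs] at this
    exact this
  · intro k
    have h4 := four_le s hs k
    generalize hm : (k:ℤ) + 4 = m at *
    have ha : 2 ≤ |2 + m * s| := by
      rw [le_abs] at *
      omega
    have hb : 2 ≤ |-1 - m * s| := by
      rw [le_abs] at *
      omega
    have ha0 : 2 + m * s ≠ 0 := by
      intro h
      simp [h] at ha
    have hb0 : -1 - m * s ≠ 0 := by
      intro h
      simp [h] at hb
    have hc0 : s + (2 + m * s) * (1 + m * s) ≠ 0 := by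
      have he : Even ((2 + m * s) * (1 + m * s)) := by
        have := Int.even_mul_succ_self (1 + m * s)
        rwa [mul_comm, show 1 + m * s + 1 = 2 + m * s by ring] at this
      intro h
      have h2 := hodd.add_even he
      rw [h] at h2
      exact absurd h2 (by decide)
    have hc2 : IsCoprime (2:ℤ) s := by
      obtain ⟨t, rfl⟩ := hodd
      exact ⟨-t, 1, by ring⟩
    refine ⟨?_, ?_, ⟨0, 1, by simp, by simpa using ha, by simpa using hb⟩, ?_⟩
    · intro i
      fin_cases i
      · simpa using ha0
      · simpa using hb0
      · simpa using hc0
    · simp only [Fin.sum_univ_three, Fin.prod_univ_three, Matrix.cons_val]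
      have ha1 : ((2 + m * s : ℤ) : ℚ) ≠ 0 := by exact_mod_cast ha0
      have hb1 : ((-1 - m * s : ℤ) : ℚ) ≠ 0 := by exact_mod_cast hb0
      have hc1 : ((s + (2 + m * s) * (1 + m * s) : ℤ) : ℚ) ≠ 0 := by exact_mod_cast hc0
      rw [inv_add_inv ha1 hb1, inv_eq_one_div, div_add_div _ _ (mul_ne_zero ha1 hb1) hc1]
      congr 1
      push_cast
      ring
    · simp only [Fin.prod_univ_three, Matrix.cons_val]
      rw [← Int.isCoprime_iff_gcd_eq_one]
      refine IsCoprime.mul_left (IsCoprime.mul_left ?_ ⟨-1, -m, by ring⟩) ?_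
      · exact IsCoprime.add_mul_right_left hc2 m
      · rw [show s + (2 + m * s) * (1 + m * s) = 2 + (1 + 3 * m + m * m * s) * s by ring]
        exact IsCoprime.add_mul_right_left hc2 _

lemma solSet_even (k : ℕ) : ∀ s : ℤ, s ≠ 0 → (solSet s (2 * k + 2)).Infinite := by
  induction k with
  | zero => exact solSet_two
  | succ k ih => exact fun s hs => solSet_step s _ (ih (-s) (neg_ne_zero.mpr hs))

lemma solSet_odd (k : ℕ) : ∀ s : ℤ, s ≠ 0 → Odd s → (solSet s (2 * k + 3)).Infinite := by
  induction k with
  | zero => exact solSet_three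
  | succ k ih => exact fun s hs ho => solSet_step s _ (ih (-s) (neg_ne_zero.mpr hs) ho.neg)

/-- **Theorem 4.2(1).** With `M_n = 1` for `n` even, `M_n = 2`
for `n` odd: if `gcd(s, M_n) = 1` then `1/x_1 + ⋯ + 1/x_n = s/(x_1 ⋯ x_n)`
has infinitely many solutions in nonzero integers with at least two
`|x_i| ≥ 2` and `gcd(x_1 ⋯ x_n, s) = 1`; if `n` is odd and `s` is even there
are no such solutions at all. -/
theorem solutions_m_zero_gcd_condition
    (s : ℤ) (hs : s ≠ 0) (n : ℕ) (hn : 2 ≤ n) :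
    (Int.gcd s (if Even n then 1 else 2) = 1 →
      {x : Fin n → ℤ |
          (∀ i, x i ≠ 0) ∧
          (∑ i, ((x i : ℚ))⁻¹) = (s : ℚ) / (∏ i, (x i : ℚ)) ∧
          (∃ i j, i ≠ j ∧ 2 ≤ |x i| ∧ 2 ≤ |x j|) ∧
          Int.gcd (∏ i, x i) s = 1}.Infinite) ∧
    (Odd n → Even s →
      ¬ ∃ x : Fin n → ℤ,
          (∀ i, x i ≠ 0) ∧
          (∑ i, ((x i : ℚ))⁻¹) = (s : ℚ) / (∏ i, (x i : ℚ)) ∧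
          Int.gcd (∏ i, x i) s = 1) := by
  refine ⟨fun hg => ?_, ?_⟩
  · change (solSet s n).Infinite
    rcases Nat.even_or_odd n with he | ho
    · obtain ⟨k, rfl⟩ : ∃ k, n = 2 * k + 2 := by
        obtain ⟨k, rfl⟩ := he
        exact ⟨k - 1, by omega⟩
      exact solSet_even k s hs
    · rw [if_neg (Nat.not_even_iff_odd.mpr ho)] at hg
      have hso : Odd s := by
        rw [← Int.not_even_iff_odd]
        intro h
        have h2 : (2:ℤ) ∣ Int.gcd s 2 := Int.dvd_coe_gcd h.two_dvd dvd_rfl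
        rw [hg] at h2
        norm_num at h2
      obtain ⟨k, rfl⟩ : ∃ k, n = 2 * k + 3 := by
        obtain ⟨k, rfl⟩ := ho
        exact ⟨k - 1, by omega⟩
      exact solSet_odd k s hs hso
  · rintro ho he ⟨x, h0, h1, h2⟩
    have hP : Odd (∏ i, x i) := by
      rw [← Int.not_even_iff_odd]
      intro h
      have h3 : (2:ℤ) ∣ Int.gcd (∏ i, x i) s := Int.dvd_coe_gcd h.two_dvd he.two_dvd
      rw [h2] at h3
      norm_num at h3
    have hy : ∀ i, ∃ y, ∏ i, x i = x i * y := fun i => Finset.dvd_prod_of_mem x (mem_univ i)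
    choose y hy using hy
    have hyo : ∀ i, Odd (y i) := fun i => by
      have := hP
      rw [hy i, Int.odd_mul] at this
      exact this.2
    have hP0 : (∏ i, (x i : ℚ)) ≠ 0 :=
      Finset.prod_ne_zero_iff.mpr fun i _ => by exact_mod_cast h0 i
    have hsum : ∑ i, y i = s := by
      rw [eq_div_iff hP0, Finset.sum_mul] at h1
      have h4 : ∀ i, ((x i : ℚ))⁻¹ * ∏ i, (x i : ℚ) = y i := fun i => by
        have h5 : (∏ i, (x i : ℚ)) = x i * y i := by exact_mod_cast hy i
        have h6 : (x i : ℚ) ≠ 0 := by exact_mod_cast h0 i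
        rw [h5, inv_mul_cancel_left₀ h6]
      simp only [h4] at h1
      exact_mod_cast h1
    have hso : Odd (∑ i, y i) := by
      choose z hz using hyo
      simp only [hz, Finset.sum_add_distrib, ← Finset.mul_sum]
      refine (even_two_mul _).add_odd ?_
      simpa using ho
    rw [hsum] at hso
    exact (Int.not_even_iff_odd.mpr hso) he
end
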